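/- arXiv:1506.00678 — 4 statements merged into one kernel-verified Lean document; each statement's English description precedes it below -/
import Mathlib

section
/- If an n×m binary matrix M can be represented by a galled tree, then M can be represented by a persistent phylogeny. -/
/-- A finite rooted tree, given by a parent function: the root is its own parent,
and every vertex reaches the root by iterating the parent function. -/
structure PhyloRootedTree where
  V : Type
  fin : Fintype V
  root : V
  parent : V → V
  parent_root : parent root = root
  reaches_root : ∀ v : V, ∃ k : ℕ, parent^[k] v = root

namespace PhyloRootedTree

/-- A vertex is a leaf if it has no children. -/
def IsLeaf (T : PhyloRootedTree) (v : T.V) : Prop :=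
  ∀ u : T.V, T.parent u = v → u = v

/-- `T.Anc u v` : vertex `u` is an ancestor of `v` (or `u = v`).
Identifying each edge of `T` with its child (non-root) endpoint, the edge with child
endpoint `u` lies on the path from the root to `v` iff `T.Anc u v` and `u ≠ T.root`. -/
def Anc (T : PhyloRootedTree) (u v : T.V) : Prop :=
  ∃ k : ℕ, T.parent^[k] v = u

end PhyloRootedTree

/-- A persistent phylogeny for a binary matrix `M` whose rows are indexed by `Fin n`
and whose columns (characters) are indexed by `κ`.  Edges of the tree are identified
with their child (non-root) endpoints.  Each character is gained (mutates 0→1) on at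
most one edge (`gain`) and lost (mutates 1→0) on at most one edge (`loss`). -/
structure PersistentPhylogeny {n : ℕ} {κ : Type} (M : Fin n → κ → Bool) where
  T : PhyloRootedTree
  /-- each taxon labels exactly one leaf -/
  leaf : Fin n → T.V
  leaf_isLeaf : ∀ f, T.IsLeaf (leaf f)
  leaf_inj : Function.Injective leaf
  /-- the edge (if any) on which character `c` is gained (mutates 0→1) -/
  gain : κ → Option T.V
  /-- the edge (if any) on which character `c` is lost (mutates 1→0) -/
  loss : κ → Option T.V
  gain_ne_root : ∀ c v, gain c = some v → v ≠ T.root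
  loss_ne_root : ∀ c v, loss c = some v → v ≠ T.root
  /-- if `c` is lost on edge `e`, then `c` is gained on an edge strictly preceding `e`
  on the path from the root to `e` -/
  loss_after_gain : ∀ c v, loss c = some v →
    ∃ u, gain c = some u ∧ u ≠ v ∧ T.Anc u v
  /-- `M f c = 1` iff on the path from the root to the leaf labeled `f`, character `c`
  is gained and is not lost -/
  path_char : ∀ f c, M f c = true ↔
    ((∃ u, gain c = some u ∧ T.Anc u (leaf f)) ∧
      ¬ (∃ v, loss c = some v ∧ T.Anc v (leaf f)))

/-- A phylogenetic network for the binary matrix `M` : a rooted DAG whose nodes are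
labeled by binary sequences of length `m`; the root is labeled all-zero; every non-root
node has in-degree 1 (a tree node) or 2 (a recombination node); each character labels
exactly one tree edge; the label of a tree node equals the label of its parent except
that exactly the characters labeling the entering edge change from 0 to 1; the label of
a recombination node is a single-breakpoint crossover of the labels of its two parents;
and every row of `M` appears as the label of some node. -/
structure PhyloNetwork {n m : ℕ} (M : Fin n → Fin m → Bool) where
  V : Type
  fin : Fintype V
  root : V
  edge : V → V → Prop
  /-- acyclicity of the directed graph, via a topological rank -/
  rank : V → ℕ
  acyclic : ∀ u v, edge u v → rank u < rank v
  label : V → Fin m → Bool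
  root_label : ∀ c, label root c = false
  root_indeg : ∀ u, ¬ edge u root
  reach : ∀ v : V, Relation.ReflTransGen edge root v
  /-- every non-root node has in-degree 1 or 2 -/
  indeg_nonroot : ∀ v, v ≠ root → {u | edge u v}.ncard = 1 ∨ {u | edge u v}.ncard = 2
  /-- each character labels exactly one tree edge -/
  charEdge : Fin m → V × V
  charEdge_isEdge : ∀ c, edge (charEdge c).1 (charEdge c).2
  charEdge_treeEdge : ∀ c, {u | edge u (charEdge c).2}.ncard = 1
  /-- label rule for tree nodes: exactly the characters labeling the entering edge
  change, from state 0 to state 1 -/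
  tree_label : ∀ u v, edge u v → {p | edge p v}.ncard = 1 →
    ∀ c, (charEdge c = (u, v) → label u c = false ∧ label v c = true) ∧
         (charEdge c ≠ (u, v) → label v c = label u c)
  /-- label rule for recombination nodes: a single-breakpoint crossover of the labels
  of the two parents -/
  recomb_label : ∀ v, {p | edge p v}.ncard = 2 →
    ∃ p₁ p₂, p₁ ≠ p₂ ∧ edge p₁ v ∧ edge p₂ v ∧
      ∃ k : ℕ, ∀ c : Fin m,
        (c.val < k → label v c = label p₁ c) ∧ (k ≤ c.val → label v c = label p₂ c)
  /-- every row of `M` appears as the label of some node -/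
  rows_appear : ∀ f : Fin n, ∃ v, ∀ c, label v c = M f c

/-- The underlying undirected graph of the network. -/
def PhyloNetwork.underlying {n m : ℕ} {M : Fin n → Fin m → Bool}
    (N : PhyloNetwork M) : SimpleGraph N.V :=
  SimpleGraph.fromRel N.edge

/-- A galled tree is a phylogenetic network in which any two cycles of the underlying
undirected graph are node-disjoint (two cycles sharing a node have the same nodes). -/
def PhyloNetwork.IsGalled {n m : ℕ} {M : Fin n → Fin m → Bool}
    (N : PhyloNetwork M) : Prop :=
  ∀ (a b : N.V) (c₁ : N.underlying.Walk a a) (c₂ : N.underlying.Walk b b),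
    c₁.IsCycle → c₂.IsCycle → (∃ v, v ∈ c₁.support ∧ v ∈ c₂.support) →
    ∀ v, v ∈ c₁.support ↔ v ∈ c₂.support

/-- generic ancestor relation -/
def GAnc {V : Type} (p : V → V) (u v : V) : Prop := ∃ k : ℕ, p^[k] v = u

namespace GAnc
variable {V : Type} {p : V → V}

theorem refl (v : V) : GAnc p v v := ⟨0, rfl⟩

theorem par (v : V) : GAnc p (p v) v := ⟨1, rfl⟩

theorem trans {a b c : V} (h1 : GAnc p a b) (h2 : GAnc p b c) : GAnc p a c := by
  obtain ⟨k, rfl⟩ := h1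
  obtain ⟨l, rfl⟩ := h2
  exact ⟨k + l, by rw [Function.iterate_add_apply]⟩

theorem cases {u v : V} (h : GAnc p u v) : u = v ∨ GAnc p u (p v) := by
  obtain ⟨k, rfl⟩ := h
  cases k with
  | zero => left; rfl
  | succ k => right; exact ⟨k, by rw [Function.iterate_succ_apply]⟩

theorem up {u v : V} (h : GAnc p u (p v)) : GAnc p u v := h.trans (par v)

theorem comparable {a b c : V} (h1 : GAnc p a c) (h2 : GAnc p b c) : GAnc p a b ∨ GAnc p b a := by
  obtain ⟨k, rfl⟩ := h1
  obtain ⟨l, rfl⟩ := h2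
  rcases le_total k l with h | h
  · right; exact ⟨l - k, by rw [← Function.iterate_add_apply]; congr 2; omega⟩
  · left; exact ⟨k - l, by rw [← Function.iterate_add_apply]; congr 2; omega⟩

/-- the child of `u` towards `v` -/
theorem child {u v : V} (h : GAnc p u v) (hne : u ≠ v) : ∃ w, p w = u ∧ GAnc p w v := by
  obtain ⟨k, rfl⟩ := h
  cases k with
  | zero => exact absurd rfl hne
  | succ k => exact ⟨p^[k] v, by rw [Function.iterate_succ_apply'], k, rfl⟩

theorem root_of {r : V} (hr : p r = r) {u : V} (h : GAnc p u r) : u = r := by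
  obtain ⟨k, rfl⟩ := h
  exact Function.iterate_fixed hr k

/-- antisymmetry in rooted trees -/
theorem antisymm {r : V} (hr : p r = r) (hreach : ∀ v, GAnc p r v) {u v : V}
    (h1 : GAnc p u v) (h2 : GAnc p v u) : u = v := by
  obtain ⟨k, hk⟩ := h1
  obtain ⟨l, hl⟩ := h2
  by_cases h0 : k = 0
  · subst h0; exact hk.symm
  have hper : p^[l + k] v = v := by rw [Function.iterate_add_apply, hk, hl]
  obtain ⟨d, hd⟩ := hreach v
  have hmul : ∀ j, p^[j * (l + k)] v = v := by
    intro j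
    induction j with
    | zero => simp
    | succ j ih => rw [Nat.succ_mul, Function.iterate_add_apply, hper, ih]
  have hbig : p^[d * (l + k)] v = r := by
    have : d * (l+k) = (d * (l + k) - d) + d := by
      have : d * 1 ≤ d * (l+k) := Nat.mul_le_mul_left _ (by omega)
      omega
    rw [this, Function.iterate_add_apply, hd]
    exact Function.iterate_fixed hr _
  have hv : v = r := by rw [← hmul d, hbig]
  subst hv
  exact root_of hr ⟨k, hk⟩

end GAnc

/-- At most one gain and one loss edge per character gives a persistent phylogeny. -/
theorem persistent_of_labels {n : ℕ} {κ : Type} (M : Fin n → κ → Bool) (V : Type) (fin : Fintype V)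
    (r : V) (p : V → V) (hr : p r = r) (hreach : ∀ v, GAnc p r v) (lab : V → κ → Bool)
    (hlr : ∀ c, lab r c = false)
    (u01 : ∀ c v w, lab (p v) c = false → lab v c = true → lab (p w) c = false → lab w c = true → v = w)
    (u10 : ∀ c v w, lab (p v) c = true → lab v c = false → lab (p w) c = true → lab w c = false → v = w)
    (row : Fin n → V) (hrow : ∀ f c, lab (row f) c = M f c) :
    Nonempty (PersistentPhylogeny M) := by
  classical
  let P : V ⊕ Fin n → V ⊕ Fin n := Sum.elim (fun v => Sum.inl (p v)) (fun f => Sum.inl (row f))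
  have hPl : ∀ k v, P^[k] (Sum.inl v) = Sum.inl (p^[k] v) := by
    intro k
    induction k with
    | zero => intro v; rfl
    | succ k ih => intro v; rw [Function.iterate_succ_apply, Function.iterate_succ_apply]; exact ih _
  have ancl : ∀ u v, GAnc P (Sum.inl u) (Sum.inl v) ↔ GAnc p u v := by
    intro u v; simp [GAnc, hPl]
  have ancr : ∀ u f, GAnc P (Sum.inl u) (Sum.inr f) ↔ GAnc p u (row f) := by
    intro u f
    constructor
    · intro h
      rcases h.cases with h | h
      · cases h
      · exact (ancl _ _).1 h
    · intro h
      exact GAnc.up (p := P) (v := Sum.inr f) ((ancl _ _).2 h)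
  have anti := fun {u v : V} => GAnc.antisymm (u := u) (v := v) hr hreach
  let T : PhyloRootedTree :=
    { V := V ⊕ Fin n
      fin := inferInstance
      root := Sum.inl r
      parent := P
      parent_root := by simp [P, hr]
      reaches_root := by
        rintro (v | f)
        · exact (ancl _ _).2 (hreach v)
        · exact (ancr _ _).2 (hreach _) }
  -- basic facts
  have g1 : ∀ c v, lab v c = true →
      ∃ u, lab (p u) c = false ∧ lab u c = true ∧ GAnc p u v := by
    intro c v
    obtain ⟨k, hk⟩ := hreach v
    induction k generalizing v with
    | zero => intro h; simp only [Function.iterate_zero, id] at hk; rw [hk, hlr] at h; cases h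
    | succ k ih =>
      intro h
      by_cases h2 : lab (p v) c = true
      · obtain ⟨u, a, b, d⟩ := ih (p v) hk h2
        exact ⟨u, a, b, d.up⟩
      · exact ⟨v, by simpa using h2, h, GAnc.refl v⟩
  have g2 : ∀ c u v, GAnc p u v → lab u c = true → lab v c = false →
      ∃ w, lab (p w) c = true ∧ lab w c = false ∧ GAnc p w v := by
    intro c u v ⟨k, hk⟩ hu
    induction k generalizing v with
    | zero => intro h; simp only [Function.iterate_zero, id] at hk; rw [hk, hu] at h; cases h
    | succ k ih =>
      intro h
      by_cases h2 : lab (p v) c = true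
      · exact ⟨v, h2, h, GAnc.refl v⟩
      · obtain ⟨w, a, b, d⟩ := ih (p v) hk (by simpa using h2)
        exact ⟨w, a, b, d.up⟩
  have g3 : ∀ c u v, GAnc p u v → lab u c = false → lab v c = true →
      ∃ w, lab (p w) c = false ∧ lab w c = true ∧ GAnc p w v ∧ GAnc p u (p w) := by
    intro c u v ⟨k, hk⟩ hu
    induction k generalizing v with
    | zero => intro h; simp only [Function.iterate_zero, id] at hk; rw [hk, hu] at h; cases h
    | succ k ih =>
      intro h
      by_cases h2 : lab (p v) c = true
      · obtain ⟨w, a, b, d, e⟩ := ih (p v) hk h2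
        exact ⟨w, a, b, d.up, e⟩
      · exact ⟨v, by simpa using h2, h, GAnc.refl v, k, hk⟩
  let G : κ → V → Prop := fun c v => lab (p v) c = false ∧ lab v c = true
  let L : κ → V → Prop := fun c v => lab (p v) c = true ∧ lab v c = false
  let gain : κ → Option (V ⊕ Fin n) := fun c =>
    if h : ∃ v, G c v then some (Sum.inl h.choose) else none
  let loss : κ → Option (V ⊕ Fin n) := fun c =>
    if h : ∃ v, L c v then some (Sum.inl h.choose) else none
  have gainI : ∀ c v, G c v → gain c = some (Sum.inl v) := by
    intro c v h
    have he : ∃ v, G c v := ⟨v, h⟩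
    have := u01 c v he.choose h.1 h.2 he.choose_spec.1 he.choose_spec.2
    simp only [gain, dif_pos he, ← this]
  have lossI : ∀ c v, L c v → loss c = some (Sum.inl v) := by
    intro c v h
    have he : ∃ v, L c v := ⟨v, h⟩
    have := u10 c v he.choose h.1 h.2 he.choose_spec.1 he.choose_spec.2
    simp only [loss, dif_pos he, ← this]
  have gainE : ∀ c x, gain c = some x → ∃ v, x = Sum.inl v ∧ G c v := by
    intro c x h
    by_cases he : ∃ v, G c v
    · simp only [gain, dif_pos he, Option.some.injEq] at h
      exact ⟨_, h.symm, he.choose_spec⟩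
    · simp [gain, dif_neg he] at h
  have lossE : ∀ c x, loss c = some x → ∃ v, x = Sum.inl v ∧ L c v := by
    intro c x h
    by_cases he : ∃ v, L c v
    · simp only [loss, dif_pos he, Option.some.injEq] at h
      exact ⟨_, h.symm, he.choose_spec⟩
    · simp [loss, dif_neg he] at h
  refine ⟨{ T := T, leaf := fun f => Sum.inr f, leaf_isLeaf := ?_, leaf_inj := Sum.inr_injective,
            gain := gain, loss := loss, gain_ne_root := ?_, loss_ne_root := ?_,
            loss_after_gain := ?_, path_char := ?_ }⟩
  · rintro f (v | g) h
    · cases h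
    · cases h
  · intro c x hx
    obtain ⟨v, rfl, h⟩ := gainE c x hx
    intro h2
    have : v = r := Sum.inl_injective h2
    subst this
    have := h.2
    rw [hlr] at this; cases this
  · intro c x hx
    obtain ⟨v, rfl, h⟩ := lossE c x hx
    intro h2
    have : v = r := Sum.inl_injective h2
    subst this
    have := h.1
    rw [hr, hlr] at this; cases this
  · intro c x hx
    obtain ⟨v, rfl, h⟩ := lossE c x hx
    obtain ⟨u, a, b, d⟩ := g1 c (p v) h.1
    refine ⟨Sum.inl u, gainI c u ⟨a, b⟩, ?_, (ancl _ _).2 d.up⟩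
    intro h2
    have : u = v := Sum.inl_injective h2
    subst this
    rw [h.2] at b; cases b
  · intro f c
    rw [← hrow]
    constructor
    · intro h
      obtain ⟨u, a, b, d⟩ := g1 c _ h
      refine ⟨⟨Sum.inl u, gainI c u ⟨a, b⟩, (ancr _ _).2 d⟩, ?_⟩
      rintro ⟨x, hx, hxa⟩
      obtain ⟨v, rfl, hv⟩ := lossE c x hx
      have hva : GAnc p v (row f) := (ancr _ _).1 hxa
      obtain ⟨w, a', b', d', e'⟩ := g3 c v _ hva hv.2 h
      obtain ⟨z, a2, b2, d2⟩ := g1 c _ hv.1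
      have := u01 c z w a2 b2 a' b'
      subst this
      have h1 : GAnc p (p v) (p z) := (GAnc.par v).trans e'
      have h2 : z = v := anti (d2.up) e'.up
      subst h2
      rw [hv.2] at b2; cases b2
    · rintro ⟨⟨x, hx, hxa⟩, hl⟩
      obtain ⟨u, rfl, hu⟩ := gainE c x hx
      by_contra h
      obtain ⟨w, a, b, d⟩ := g2 c u (row f) ((ancr _ _).1 hxa) hu.2 (by simpa using h)
      exact hl ⟨Sum.inl w, lossI c w ⟨a, b⟩, (ancr _ _).2 d⟩

/-- Abstract combinatorial data extracted from a galled tree. -/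
structure GData (V κ : Type) where
  r : V
  π : V → V
  q : V → V
  R : V → Prop
  rank : V → ℕ
  lab : V → κ → Bool
  h : κ → V
  π_root : π r = r
  rank_lt : ∀ v, v ≠ r → rank (π v) < rank v
  tree : ∀ v, v ≠ r → ¬ R v → ∀ c, (h c = v → lab (π v) c = false ∧ lab v c = true) ∧
    (h c ≠ v → lab v c = lab (π v) c)
  hR : ∀ c, ¬ R (h c)
  R_root : ∀ x, R x → x ≠ r
  q_rank : ∀ x, R x → rank (q x) < rank x
  rec_lab : ∀ x, R x → ∀ c, lab x c = lab (π x) c ∨ lab x c = lab (q x) c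
  disj : ∀ x y v, R x → R y →
    ((GAnc π v (q x) ∧ ¬ GAnc π v x) ∨ (GAnc π v x ∧ ¬ GAnc π v (q x))) →
    ((GAnc π v (q y) ∧ ¬ GAnc π v y) ∨ (GAnc π v y ∧ ¬ GAnc π v (q y))) → x = y

/-- ranks decrease towards the root, so everything reaches the root -/
theorem reach_of_rank {V : Type} (r : V) (π : V → V) (rank : V → ℕ)
    (h : ∀ v, v ≠ r → rank (π v) < rank v) (v : V) : GAnc π r v := by
  induction hn : rank v using Nat.strong_induction_on generalizing v with
  | _ n ih =>
    by_cases hv : v = r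
    · subst hv; exact GAnc.refl _
    · exact (ih _ (hn ▸ h v hv) (π v) rfl).up

theorem rank_of_anc {V : Type} (r : V) (π : V → V) (rank : V → ℕ) (hr : π r = r)
    (h : ∀ v, v ≠ r → rank (π v) < rank v) {u v : V} (ha : GAnc π u v) :
    u = v ∨ rank u < rank v := by
  obtain ⟨k, hk⟩ := ha
  induction k generalizing v with
  | zero => left; exact hk.symm
  | succ k ih =>
    by_cases hv : v = r
    · subst hv
      left
      exact hk ▸ Function.iterate_fixed hr _
    · right
      rcases ih hk with h1 | h1
      · rw [h1]; exact h v hv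
      · exact h1.trans (h v hv)

namespace GData
variable {V κ : Type} (D : GData V κ)

def Q (x v : V) : Prop := D.R x ∧ GAnc D.π v (D.q x) ∧ ¬ GAnc D.π v x
def P (x v : V) : Prop := D.R x ∧ GAnc D.π v x ∧ ¬ GAnc D.π v (D.q x)

theorem reach (v : V) : GAnc D.π D.r v := reach_of_rank _ _ _ D.rank_lt v
theorem anc_rank {u v : V} (h : GAnc D.π u v) : u = v ∨ D.rank u < D.rank v :=
  rank_of_anc _ _ _ D.π_root D.rank_lt h
theorem anti {u v : V} (h1 : GAnc D.π u v) (h2 : GAnc D.π v u) : u = v :=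
  GAnc.antisymm D.π_root D.reach h1 h2

theorem P_self {x : V} (h : D.R x) : D.P x x := by
  refine ⟨h, GAnc.refl _, fun h2 => ?_⟩
  have := D.q_rank x h
  rcases D.anc_rank h2 with h3 | h3
  · rw [← h3] at this; omega
  · omega

theorem PP {x y v : V} (h1 : D.P x v) (h2 : D.P y v) : x = y :=
  D.disj x y v h1.1 h2.1 (Or.inr h1.2) (Or.inr h2.2)
theorem QQ {x y v : V} (h1 : D.Q x v) (h2 : D.Q y v) : x = y :=
  D.disj x y v h1.1 h2.1 (Or.inl h1.2) (Or.inl h2.2)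
theorem PQ {x y v : V} (h1 : D.P x v) (h2 : D.Q y v) : False := by
  have := D.disj x y v h1.1 h2.1 (Or.inr h1.2) (Or.inl h2.2)
  subst this
  exact h2.2.2 h1.2.1

theorem Q_tree {x v : V} (h : D.Q x v) : ¬ D.R v := fun hv => D.PQ (D.P_self hv) h
theorem P_tree {x v : V} (h : D.P x v) (hne : v ≠ x) : ¬ D.R v :=
  fun hv => hne (D.PP (D.P_self hv) h)
theorem Q_ne_root {x v : V} (h : D.Q x v) : v ≠ D.r := by
  rintro rfl; exact h.2.2 (D.reach x)
theorem P_ne_root {x v : V} (h : D.P x v) : v ≠ D.r := by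
  rintro rfl; exact h.2.2 (D.reach _)

theorem lca (u w : V) : ∃ a, GAnc D.π a u ∧ GAnc D.π a w ∧
    ∀ y, GAnc D.π y u → GAnc D.π y w → GAnc D.π y a := by
  induction hn : D.rank u using Nat.strong_induction_on generalizing u with
  | _ n ih =>
    by_cases huw : GAnc D.π u w
    · exact ⟨u, GAnc.refl _, huw, fun y h _ => h⟩
    · have hu : u ≠ D.r := by rintro rfl; exact huw (D.reach w)
      obtain ⟨a, h1, h2, h3⟩ := ih _ (hn ▸ D.rank_lt u hu) (D.π u) rfl
      refine ⟨a, h1.up, h2, fun y hy hyw => ?_⟩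
      rcases hy.cases with rfl | h
      · exact absurd hyw huw
      · exact h3 y h hyw

theorem chain {a v : V} (c : κ) (ha : GAnc D.π a v)
    (ht : ∀ y, GAnc D.π y v → GAnc D.π a y → y ≠ a → y ≠ D.r ∧ ¬ D.R y) :
    D.lab v c = D.lab a c ∨ (D.lab a c = false ∧ D.lab v c = true ∧
      GAnc D.π (D.h c) v ∧ GAnc D.π a (D.h c) ∧ D.h c ≠ a) := by
  obtain ⟨k, hk⟩ := ha
  induction k generalizing v with
  | zero => left; rw [← hk]; rfl
  | succ k ih =>
    by_cases hva : v = a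
    · left; rw [hva]
    have hav : GAnc D.π a v := ⟨k+1, hk⟩
    have hh := ht v (GAnc.refl v) hav hva
    have tl := D.tree v hh.1 hh.2 c
    have := ih (v := D.π v) (fun y hy => ht y hy.up) hk
    by_cases hc : D.h c = v
    · right
      have t := tl.1 hc
      refine ⟨?_, t.2, hc ▸ GAnc.refl _, hc ▸ hav, hc ▸ hva⟩
      rcases this with h | h
      · rw [← h]; exact t.1
      · exact h.1
    · rw [tl.2 hc]
      rcases this with h | ⟨h1, h2, h3, h4⟩
      · left; exact h
      · right; exact ⟨h1, h2, h3.up, h4⟩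

theorem key {x : V} (hx : D.R x) (c : κ) :
    (D.lab (D.q x) c = true → D.lab (D.π x) c = false → D.Q x (D.h c)) ∧
    (D.lab (D.q x) c = false → D.lab (D.π x) c = true → D.P x (D.h c)) := by
  obtain ⟨a, a1, a2, a3⟩ := D.lca (D.π x) (D.q x)
  have hxx := (D.P_self hx).2.2
  have hne : ∀ y, GAnc D.π y (D.π x) → y ≠ x := by
    rintro y hy rfl
    have := D.rank_lt y (D.R_root y hx)
    rcases D.anc_rank hy with h | h
    · rw [← h] at this; omega
    · omega
  have cp := D.chain c a1 (fun y hy hay hya => by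
    have : D.P x y := ⟨hx, hy.up, fun h => hya (D.anti (a3 y hy h) hay)⟩
    exact ⟨D.P_ne_root this, D.P_tree this (hne y hy)⟩)
  have up : ∀ y, GAnc D.π y (D.q x) → GAnc D.π y x → GAnc D.π y (D.π x) := by
    intro y h1 h2
    rcases h2.cases with rfl | h
    · exact absurd h1 hxx
    · exact h
  have cq := D.chain c a2 (fun y hy hay hya => by
    have : D.Q x y := ⟨hx, hy, fun h => hya (D.anti (a3 y (up y hy h) hy) hay)⟩
    exact ⟨D.Q_ne_root this, D.Q_tree this⟩)
  constructor
  · intro h1 h2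
    rcases cq with h | ⟨l1, l2, h3, h4, h5⟩
    · exfalso
      rw [h1] at h
      rcases cp with h' | h' <;> simp_all
    · exact ⟨hx, h3, fun h => h5 (D.anti (a3 _ (up _ h3 h) h3) h4)⟩
  · intro h1 h2
    rcases cp with h | ⟨l1, l2, h3, h4, h5⟩
    · exfalso
      rw [h2] at h
      rcases cq with h' | h' <;> simp_all
    · exact ⟨hx, h3.up, fun h => h5 (D.anti (a3 _ h3 h) h4)⟩

/-- the rerouted parent function -/
theorem exists_par : ∃ p : V → V, (∀ v, (∀ x, ¬ D.Q x v) → p v = D.π v) ∧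
    (∀ x v, D.Q x v → (v = D.q x ∧ p v = x) ∨ (v ≠ D.q x ∧ D.π (p v) = v ∧ D.Q x (p v))) := by
  have : ∀ v, ∃ w, ((∀ x, ¬ D.Q x v) → w = D.π v) ∧
    (∀ x, D.Q x v → (v = D.q x ∧ w = x) ∨ (v ≠ D.q x ∧ D.π w = v ∧ D.Q x w)) := by
    intro v
    by_cases h : ∃ x, D.Q x v
    · obtain ⟨x, hx⟩ := h
      by_cases hv : v = D.q x
      · refine ⟨x, fun h => absurd hx (h x), fun y hy => ?_⟩
        have := D.QQ hx hy
        subst this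
        exact Or.inl ⟨hv, rfl⟩
      · obtain ⟨w, hw1, hw2⟩ := hx.2.1.child hv
        refine ⟨w, fun h => absurd hx (h x), fun y hy => ?_⟩
        have := D.QQ hx hy
        subst this
        refine Or.inr ⟨hv, hw1, hx.1, hw2, fun h => hx.2.2 ?_⟩
        rw [← hw1]
        exact (GAnc.par w).trans h
    · push Not at h
      exact ⟨D.π v, fun _ => rfl, fun x hx => absurd hx (h x)⟩
  choose p hp using this
  exact ⟨p, fun v => (hp v).1, fun x v => (hp v).2 x⟩

variable {D} {p : V → V} (hp1 : ∀ v, (∀ x, ¬ D.Q x v) → p v = D.π v)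
  (hp2 : ∀ x v, D.Q x v → (v = D.q x ∧ p v = x) ∨ (v ≠ D.q x ∧ D.π (p v) = v ∧ D.Q x (p v)))

include hp2 in
theorem Q_to_x {x v : V} (h : D.Q x v) : GAnc p x v := by
  induction hn : D.rank (D.q x) - D.rank v using Nat.strong_induction_on generalizing v with
  | _ n ih =>
    rcases hp2 x v h with ⟨_, h2⟩ | ⟨h1, h2, h3⟩
    · exact h2 ▸ GAnc.par v
    · have a := D.rank_lt _ (D.Q_ne_root h3)
      rw [h2] at a
      have b : D.rank (p v) ≤ D.rank (D.q x) := by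
        rcases D.anc_rank h3.2.1 with h | h
        · rw [h]
        · omega
      exact (ih _ (by omega) h3 rfl).up

include hp1 in
theorem P_up {x v : V} (h : D.P x v) :
    ∃ a, GAnc p a v ∧ GAnc D.π a x ∧ GAnc D.π a (D.q x) := by
  induction hn : D.rank v using Nat.strong_induction_on generalizing v with
  | _ n ih =>
    have e := hp1 v (fun y hy => D.PQ h hy)
    by_cases hq : GAnc D.π (D.π v) (D.q x)
    · exact ⟨D.π v, e ▸ GAnc.par v, (GAnc.par v).trans h.2.1, hq⟩
    · obtain ⟨a, h1, h2⟩ := ih _ (hn ▸ D.rank_lt v (D.P_ne_root h))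
        (v := D.π v) ⟨h.1, (GAnc.par v).trans h.2.1, hq⟩ rfl
      exact ⟨a, GAnc.up (e ▸ h1), h2⟩

include hp1 hp2 in
theorem p_reach (v : V) : GAnc p D.r v := by
  induction hn : D.rank v using Nat.strong_induction_on generalizing v with
  | _ n ih =>
    by_cases h : ∃ x, D.Q x v
    · obtain ⟨x, hx⟩ := h
      obtain ⟨a, h1, h2, h3⟩ := P_up hp1 (D.P_self hx.1)
      have hr : D.rank a < D.rank v := by
        rcases h3.comparable hx.2.1 with h | h
        · rcases D.anc_rank h with h4 | h4
          · subst h4; exact absurd h2 hx.2.2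
          · exact h4
        · exact absurd (h.trans h2) hx.2.2
      exact (ih _ (hn ▸ hr) a rfl).trans (h1.trans (Q_to_x hp2 hx))
    · push Not at h
      by_cases hv : v = D.r
      · subst hv; exact GAnc.refl _
      · refine GAnc.up ?_
        rw [hp1 v h]
        exact ih _ (hn ▸ D.rank_lt v hv) _ rfl

include hp1 hp2 in
theorem E01 {c : κ} {v : V} (h0 : D.lab (p v) c = false) (h1 : D.lab v c = true) :
    ((∀ x, ¬ D.Q x (D.h c)) ∧ v = D.h c) ∨
    (∃ x, D.Q x (D.h c) ∧ D.lab x c = true ∧ v = x) ∨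
    (∃ x, D.Q x (D.h c) ∧ D.lab x c = false ∧ v = D.q x) := by
  by_cases h : ∃ x, D.Q x v
  · obtain ⟨x, hx⟩ := h
    rcases hp2 x v hx with ⟨h3, h2⟩ | ⟨_, h2, h3⟩
    · right; right
      rw [h2] at h0
      rw [h3] at h1
      have := D.rec_lab x hx.1 c
      refine ⟨x, (D.key hx.1 c).1 h1 ?_, h0, h3⟩
      simp_all
    · exfalso
      have t := D.tree _ (D.Q_ne_root h3) (D.Q_tree h3) c
      rw [h2, h0, h1] at t
      by_cases hc : D.h c = p v
      · simpa using t.1 hc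
      · simpa using t.2 hc
  · push Not at h
    rw [hp1 v h] at h0
    by_cases hv : v = D.r
    · subst hv; rw [D.π_root, h1] at h0; cases h0
    by_cases hR : D.R v
    · right; left
      have := D.rec_lab v hR c
      refine ⟨v, (D.key hR c).1 ?_ h0, h1, rfl⟩
      simp_all
    · left
      have t := D.tree v hv hR c
      by_cases hc : D.h c = v
      · exact ⟨hc ▸ h, hc.symm⟩
      · have := t.2 hc
        rw [h0, h1] at this; cases this

include hp1 hp2 in
theorem E10 {c : κ} {v : V} (h0 : D.lab (p v) c = true) (h1 : D.lab v c = false) :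
    (∃ x, D.P x (D.h c) ∧ D.lab x c = false ∧ v = x) ∨
    (∃ x, D.P x (D.h c) ∧ D.lab x c = true ∧ v = D.q x) ∨
    (∃ x, D.Q x (D.h c) ∧ v = D.π (D.h c)) := by
  by_cases h : ∃ x, D.Q x v
  · obtain ⟨x, hx⟩ := h
    rcases hp2 x v hx with ⟨h3, h2⟩ | ⟨_, h2, h3⟩
    · right; left
      rw [h2] at h0
      rw [h3] at h1
      have := D.rec_lab x hx.1 c
      refine ⟨x, (D.key hx.1 c).2 h1 ?_, h0, h3⟩
      simp_all
    · right; right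
      have t := D.tree _ (D.Q_ne_root h3) (D.Q_tree h3) c
      rw [h2, h0, h1] at t
      by_cases hc : D.h c = p v
      · exact ⟨x, hc ▸ h3, hc ▸ h2.symm⟩
      · simpa using t.2 hc
  · push Not at h
    rw [hp1 v h] at h0
    by_cases hv : v = D.r
    · subst hv; rw [D.π_root, h1] at h0; cases h0
    by_cases hR : D.R v
    · left
      have := D.rec_lab v hR c
      refine ⟨v, (D.key hR c).2 ?_ h0, h1, rfl⟩
      simp_all
    · exfalso
      have t := D.tree v hv hR c
      by_cases hc : D.h c = v
      · have := (t.1 hc).1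
        rw [h0] at this; cases this
      · have := t.2 hc
        rw [h0, h1] at this; cases this

end GData

theorem persistent_of_GData {n : ℕ} {V κ : Type} (fin : Fintype V) (D : GData V κ)
    (hlr : ∀ c, D.lab D.r c = false) (M : Fin n → κ → Bool)
    (row : Fin n → V) (hrow : ∀ f c, D.lab (row f) c = M f c) :
    Nonempty (PersistentPhylogeny M) := by
  obtain ⟨p, hp1, hp2⟩ := D.exists_par
  refine persistent_of_labels M V fin D.r p ?_ (GData.p_reach hp1 hp2) D.lab hlr ?_ ?_ row hrow
  · rw [hp1 _ (fun x hx => D.Q_ne_root hx rfl), D.π_root]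
  · intro c v w a b a' b'
    rcases GData.E01 hp1 hp2 a b with ⟨h1, h2⟩ | ⟨x, h1, h2, h3⟩ | ⟨x, h1, h2, h3⟩ <;>
    rcases GData.E01 hp1 hp2 a' b' with ⟨g1, g2⟩ | ⟨y, g1, g2, g3⟩ | ⟨y, g1, g2, g3⟩
    · rw [h2, g2]
    · exact absurd g1 (h1 y)
    · exact absurd g1 (h1 y)
    · exact absurd h1 (g1 x)
    · rw [h3, g3]; exact D.QQ h1 g1
    · have := D.QQ h1 g1
      subst this; rw [h2] at g2; cases g2
    · exact absurd h1 (g1 x)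
    · have := D.QQ h1 g1
      subst this; rw [h2] at g2; cases g2
    · rw [h3, g3, D.QQ h1 g1]
  · intro c v w a b a' b'
    rcases GData.E10 hp1 hp2 a b with ⟨x, h1, h2, h3⟩ | ⟨x, h1, h2, h3⟩ | ⟨x, h1, h2⟩ <;>
    rcases GData.E10 hp1 hp2 a' b' with ⟨y, g1, g2, g3⟩ | ⟨y, g1, g2, g3⟩ | ⟨y, g1, g2⟩
    · rw [h3, g3]; exact D.PP h1 g1
    · have := D.PP h1 g1
      subst this; rw [h2] at g2; cases g2
    · exact (D.PQ h1 g1).elim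
    · have := D.PP h1 g1
      subst this; rw [h2] at g2; cases g2
    · rw [h3, g3, D.PP h1 g1]
    · exact (D.PQ h1 g1).elim
    · exact (D.PQ g1 h1).elim
    · exact (D.PQ g1 h1).elim
    · rw [h2, g2]

/-- the fundamental cycle -/
theorem fund_cycle {V : Type} (G : SimpleGraph V) (r : V) (π : V → V) (rank : V → ℕ)
    (hr : π r = r) (hlt : ∀ v, v ≠ r → rank (π v) < rank v) (hG : ∀ v, v ≠ r → G.Adj v (π v))
    (x q : V) (hqx : rank q < rank x) (hne : q ≠ π x) (hadj : G.Adj q x) :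
    ∃ w : G.Walk q q, w.IsCycle ∧
      (∀ v, v ∈ w.support → GAnc π v x ∨ GAnc π v q) ∧
      (∀ v, ((GAnc π v q ∧ ¬ GAnc π v x) ∨ (GAnc π v x ∧ ¬ GAnc π v q)) → v ∈ w.support) := by
  classical
  let H : SimpleGraph V := SimpleGraph.fromRel (fun y z => π y = z ∧ (GAnc π y x ∨ GAnc π y q))
  have hHG : H ≤ G := by
    intro y z hyz
    simp only [H, SimpleGraph.fromRel_adj] at hyz
    obtain ⟨hn, ⟨h, _⟩ | ⟨h, _⟩⟩ := hyz
    · have : y ≠ r := by rintro rfl; exact hn (hr ▸ h)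
      exact h ▸ hG y this
    · have : z ≠ r := by rintro rfl; exact hn (hr ▸ h).symm
      exact (h ▸ hG z this).symm
  have hreach : ∀ v, (GAnc π v x ∨ GAnc π v q) → H.Reachable v r := by
    intro v hv
    induction hn : rank v using Nat.strong_induction_on generalizing v with
    | _ n ih =>
      by_cases hvr : v = r
      · subst hvr; exact SimpleGraph.Reachable.refl _
      · have hlt' := hlt v hvr
        have a : H.Adj v (π v) := by
          refine (SimpleGraph.fromRel_adj _ _ _).2 ⟨fun h => ?_, Or.inl ⟨rfl, hv⟩⟩
          rw [← h] at hlt'; omega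
        refine a.reachable.trans (ih _ (hn ▸ hlt') (π v) ?_ rfl)
        exact hv.imp (fun h => (GAnc.par v).trans h) (fun h => (GAnc.par v).trans h)
  have hxq : H.Reachable x q :=
    (hreach x (Or.inl (GAnc.refl _))).trans (hreach q (Or.inr (GAnc.refl _))).symm
  obtain ⟨p, hp⟩ := hxq.exists_isPath
  have sup : ∀ (a b : V) (w : H.Walk a b), (GAnc π a x ∨ GAnc π a q) →
      ∀ v ∈ w.support, GAnc π v x ∨ GAnc π v q := by
    intro a b w
    induction w with
    | nil => intro h v hv; simp at hv; exact hv ▸ h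
    | cons hadj w ih =>
      intro h v hv
      simp only [SimpleGraph.Walk.support_cons, List.mem_cons] at hv
      rcases hv with rfl | hv
      · exact h
      · refine ih ?_ v hv
        simp only [H, SimpleGraph.fromRel_adj] at hadj
        obtain ⟨_, ⟨e, _⟩ | ⟨_, e⟩⟩ := hadj
        · subst e
          exact h.imp (fun h => (GAnc.par _).trans h) (fun h => (GAnc.par _).trans h)
        · exact e
  have sep : ∀ (v a b : V) (w : H.Walk a b), GAnc π v a → ¬ GAnc π v b → v ∈ w.support := by
    intro v a b w
    induction w with
    | nil => intro h1 h2; exact absurd h1 h2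
    | @cons a z b hadj w ih =>
      intro h1 h2
      simp only [SimpleGraph.Walk.support_cons, List.mem_cons]
      by_cases hz : GAnc π v z
      · right; exact ih hz h2
      · left
        simp only [H, SimpleGraph.fromRel_adj] at hadj
        obtain ⟨_, ⟨e, _⟩ | ⟨e, _⟩⟩ := hadj
        · subst e
          exact h1.cases.resolve_right hz
        · subst e; exact absurd h1.up hz
  have hxr : x ≠ r := by
    rintro rfl
    rcases rank_of_anc x π rank hr hlt (reach_of_rank x π rank hlt q) with h | h
    · subst h; omega
    · omega
  refine ⟨SimpleGraph.Walk.cons hadj (p.mapLe hHG), ?_, ?_, ?_⟩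
  · rw [SimpleGraph.Walk.cons_isCycle_iff]
    refine ⟨hp.mapLe hHG, fun he => ?_⟩
    have he' : s(q, x) ∈ p.edges := by simpa using he
    have := p.adj_of_mem_edges he'
    simp only [H, SimpleGraph.fromRel_adj] at this
    obtain ⟨_, ⟨e, _⟩ | ⟨e, _⟩⟩ := this
    · have : GAnc π x q := e ▸ GAnc.par q
      rcases rank_of_anc r π rank hr hlt this with h | h
      · subst h; omega
      · omega
    · exact hne e.symm
  · intro v hv
    simp only [SimpleGraph.Walk.support_cons, List.mem_cons, SimpleGraph.Walk.support_mapLe_eq_support] at hv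
    rcases hv with rfl | hv
    · exact Or.inr (GAnc.refl _)
    · exact sup _ _ p (Or.inl (GAnc.refl _)) v hv
  · intro v hv
    simp only [SimpleGraph.Walk.support_cons, List.mem_cons, SimpleGraph.Walk.support_mapLe_eq_support]
    right
    rcases hv with ⟨h1, h2⟩ | ⟨h1, h2⟩
    · have := sep v _ _ p.reverse h1 h2
      simpa using this
    · exact sep v _ _ p h1 h2

/-- If a binary matrix `M` can be represented by a galled tree, then `M` can be
represented by a persistent phylogeny. -/
theorem persistentPhylogeny_of_galledTree (n m : ℕ) (M : Fin n → Fin m → Bool)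
    (h : ∃ N : PhyloNetwork M, N.IsGalled) :
    Nonempty (PersistentPhylogeny M) := by
  classical
  obtain ⟨N, hN⟩ := h
  have ex : ∀ v : N.V, ∃ pq : N.V × N.V, (v = N.root → pq.1 = v) ∧ (v ≠ N.root → N.edge pq.1 v) ∧
      ({u | N.edge u v}.ncard = 2 → pq.2 ≠ pq.1 ∧ N.edge pq.2 v ∧
        ∀ c, N.label v c = N.label pq.1 c ∨ N.label v c = N.label pq.2 c) := by
    intro v
    by_cases hv : v = N.root
    · refine ⟨(v, v), fun _ => rfl, fun h => absurd hv h, fun h2 => ?_⟩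
      exfalso
      have : {u | N.edge u v} = ∅ := by
        ext u; simp [hv, N.root_indeg]
      rw [this] at h2; simp at h2
    · by_cases h2 : {u | N.edge u v}.ncard = 2
      · obtain ⟨p₁, p₂, hne, e1, e2, k, hk⟩ := N.recomb_label v h2
        refine ⟨(p₁, p₂), fun h => absurd h hv, fun _ => e1, fun _ => ⟨hne.symm, e2, fun c => ?_⟩⟩
        rcases lt_or_ge c.val k with h | h
        · exact Or.inl ((hk c).1 h)
        · exact Or.inr ((hk c).2 h)
      · have h1 := (N.indeg_nonroot v hv).resolve_right h2
        obtain ⟨u, hu⟩ := Set.ncard_eq_one.1 h1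
        have : N.edge u v := by
          have : u ∈ {u | N.edge u v} := by rw [hu]; rfl
          exact this
        exact ⟨(u, u), fun h => absurd h hv, fun _ => this, fun h => absurd h h2⟩
  choose pq h1 h2 h3 using ex
  choose row hrow using N.rows_appear
  have hlt : ∀ v, v ≠ N.root → N.rank (pq v).1 < N.rank v := fun v hv => N.acyclic _ _ (h2 v hv)
  have adjE : ∀ u v, N.edge u v → N.underlying.Adj u v := by
    intro u v he
    refine (SimpleGraph.fromRel_adj _ _ _).2 ⟨?_, Or.inl he⟩
    rintro rfl
    exact lt_irrefl _ (N.acyclic _ _ he)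
  have hroot : (pq N.root).1 = N.root := h1 _ rfl
  have cyc : ∀ x, {u | N.edge u x}.ncard = 2 → _ := fun x hx =>
    fund_cycle N.underlying N.root (fun v => (pq v).1) N.rank hroot hlt
      (fun v hv => (adjE _ _ (h2 v hv)).symm) x (pq x).2 (N.acyclic _ _ (h3 x hx).2.1)
      (h3 x hx).1 (adjE _ _ (h3 x hx).2.1)
  let D : GData N.V (Fin m) :=
    { r := N.root
      π := fun v => (pq v).1
      q := fun v => (pq v).2
      R := fun v => {u | N.edge u v}.ncard = 2
      rank := N.rank
      lab := N.label
      h := fun c => (N.charEdge c).2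
      π_root := hroot
      rank_lt := hlt
      tree := by
        intro v hv hR c
        have hc1 := (N.indeg_nonroot v hv).resolve_right hR
        have := N.tree_label _ v (h2 v hv) hc1 c
        refine ⟨fun h => this.1 ?_, fun h => this.2 ?_⟩
        · have he := N.charEdge_isEdge c
          obtain ⟨u, hu⟩ := Set.ncard_eq_one.1 hc1
          have m1 : (N.charEdge c).1 ∈ {u | N.edge u v} := by rw [← h]; exact he
          have m2 : (pq v).1 ∈ {u | N.edge u v} := h2 v hv
          rw [hu] at m1 m2
          exact Prod.ext (m1.trans m2.symm) h
        · intro h'; exact h (by rw [h'])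
      hR := by
        intro c h
        have := N.charEdge_treeEdge c
        omega
      R_root := by
        intro x hx hxr
        have : {u | N.edge u x} = ∅ := by
          ext u; simp [hxr, N.root_indeg]
        rw [this] at hx; simp at hx
      q_rank := fun x hx => N.acyclic _ _ (h3 x hx).2.1
      rec_lab := fun x hx => (h3 x hx).2.2
      disj := by
        intro x y v hx hy hvx hvy
        obtain ⟨w, w1, w2, w3⟩ := cyc x hx
        obtain ⟨z, z1, z2, z3⟩ := cyc y hy
        have same := hN _ _ w z w1 z1 ⟨v, w3 v hvx, z3 v hvy⟩
        have rk := fun {u v : N.V} => rank_of_anc (u := u) (v := v) N.root (fun v => (pq v).1) N.rank hroot hlt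
        have qx := N.acyclic _ _ (h3 x hx).2.1
        have qy := N.acyclic _ _ (h3 y hy).2.1
        have mx : x ∈ w.support := w3 x (Or.inr ⟨GAnc.refl _, fun h => by
          rcases rk h with h | h
          · rw [← h] at qx; omega
          · omega⟩)
        have my : y ∈ z.support := z3 y (Or.inr ⟨GAnc.refl _, fun h => by
          rcases rk h with h | h
          · rw [← h] at qy; omega
          · omega⟩)
        have a : x = y ∨ N.rank x < N.rank y := by
          rcases z2 x ((same x).1 mx) with h | h
          · exact rk h
          · right
            rcases rk h with h | h
            · rw [h]; exact qy
            · omega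
        have b : y = x ∨ N.rank y < N.rank x := by
          rcases w2 y ((same y).2 my) with h | h
          · exact rk h
          · right
            rcases rk h with h | h
            · rw [h]; exact qx
            · omega
        rcases a with a | a
        · exact a
        · rcases b with b | b
          · exact b.symm
          · omega }
  exact persistent_of_GData N.fin D N.root_label M row hrow
end

section
/- Let M be an n×m binary matrix and let M_e be the extended matrix obtained from M. Then M can be represented by a persistent phylogeny if and only if there is a completion M'_e of M_e such that no pair of columns of M'_e is conflicted, i.e., no pair of columns of M'_e contains all three of the binary pairs (0,1), (1,0), and (1,1) among its rows. -/
/-- Columns `c` and `d` of a binary matrix `A` are conflicted if some three rows exhibit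
the binary pairs (0,1), (1,0) and (1,1) in columns `(c, d)`. -/
def Conflicted {ι κ : Type} (A : ι → κ → Bool) (c d : κ) : Prop :=
  (∃ r, A r c = false ∧ A r d = true) ∧
  (∃ r, A r c = true ∧ A r d = false) ∧
  (∃ r, A r c = true ∧ A r d = true)

/-- The extended matrix `M_e` of `M` has two columns `(j, false) = j₁` and
`(j, true) = j₂` for each column `j` of `M`: if `M r j = 1` then
`M_e r j₁ = 1` and `M_e r j₂ = 0`; if `M r j = 0` then both entries are `?`
(twin cells).  A completion `M'` of `M_e` replaces each `?` by `0` or `1`,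
giving twin cells equal values.  `IsCompletion M M'` says that the binary matrix
`M'` (with columns indexed by `Fin m × Bool`) is a completion of `M_e`. -/
def IsCompletion {n m : ℕ} (M : Fin n → Fin m → Bool)
    (M' : Fin n → Fin m × Bool → Bool) : Prop :=
  ∀ (r : Fin n) (j : Fin m),
    (M r j = true → M' r (j, false) = true ∧ M' r (j, true) = false) ∧
    (M r j = false → M' r (j, false) = M' r (j, true))

theorem anc_total (T : PhyloRootedTree) {u v w : T.V} (hu : T.Anc u w) (hv : T.Anc v w) :
    T.Anc u v ∨ T.Anc v u := by
  obtain ⟨a, rfl⟩ := hu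
  obtain ⟨b, rfl⟩ := hv
  rcases le_total a b with h | h
  · right
    refine ⟨b - a, ?_⟩
    rw [← Function.iterate_add_apply, Nat.sub_add_cancel h]
  · left
    refine ⟨a - b, ?_⟩
    rw [← Function.iterate_add_apply, Nat.sub_add_cancel h]

theorem anc_trans (T : PhyloRootedTree) {u v w : T.V} (hu : T.Anc u v) (hv : T.Anc v w) :
    T.Anc u w := by
  obtain ⟨a, rfl⟩ := hu
  obtain ⟨b, rfl⟩ := hv
  exact ⟨a + b, Function.iterate_add_apply _ _ _ _⟩

theorem exists_tree {α : Type} [Fintype α] [PartialOrder α] (b : α) (hb : ∀ x, b ≤ x)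
    (hch : ∀ u v w : α, u ≤ w → v ≤ w → u ≤ v ∨ v ≤ u) :
    ∃ p : α → α, p b = b ∧ (∀ v, ∀ u, (∃ k : ℕ, p^[k] v = u) ↔ u ≤ v) ∧
      (∀ v, v ≠ b → p v < v) := by
  classical
  have hex : ∀ v : α, ∃ q : α, (v = b → q = b) ∧ (v ≠ b → q < v ∧ ∀ u, u < v → u ≤ q) := by
    intro v
    by_cases hv : v = b
    · exact ⟨b, fun _ => rfl, fun h => absurd hv h⟩
    · have hne : (Set.Iio v).Nonempty := ⟨b, lt_of_le_of_ne (hb v) (Ne.symm hv)⟩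
      obtain ⟨q, hq⟩ := (Set.toFinite (Set.Iio v)).exists_maximal hne
      refine ⟨q, fun h => absurd h hv, fun _ => ⟨hq.1, fun u hu => ?_⟩⟩
      rcases hch u q v hu.le (le_of_lt hq.1) with h | h
      · exact h
      · exact hq.2 hu h
  choose p hp1 hp2 using hex
  have hle : ∀ v, p v ≤ v := by
    intro v
    by_cases hv : v = b
    · rw [hp1 v hv]; exact hb v
    · exact (hp2 v hv).1.le
  refine ⟨p, hp1 b rfl, ?_, fun v hv => (hp2 v hv).1⟩
  intro v u
  constructor
  · rintro ⟨k, rfl⟩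
    induction k with
    | zero => exact le_rfl
    | succ k ih =>
      rw [Function.iterate_succ_apply']
      exact (hle _).trans ih
  · induction v using WellFoundedLT.induction with
    | ind v ih =>
      intro huv
      rcases huv.eq_or_lt with h | h
      · exact ⟨0, h.symm⟩
      · have hv : v ≠ b := fun e => absurd (hb u) (not_le_of_gt (e ▸ h))
        obtain ⟨k, hk⟩ := ih (p v) (hp2 v hv).1 ((hp2 v hv).2 u h)
        exact ⟨k + 1, hk⟩

/-- The support of a column. -/
def colSet {n : ℕ} {κ : Type} (A : Fin n → κ → Bool) (c : κ) : Finset (Fin n) :=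
  Finset.univ.filter fun r => A r c = true

theorem mem_colSet {n : ℕ} {κ : Type} (A : Fin n → κ → Bool) (c : κ) (r : Fin n) :
    r ∈ colSet A c ↔ A r c = true := by simp [colSet]

/-- Vertices of the tree built from a laminar family of columns. -/
def LamV {n : ℕ} {κ : Type} (A : Fin n → κ → Bool) : Type :=
  {x : (Finset (Fin n))ᵒᵈ × Fin 3 // x = (OrderDual.toDual Finset.univ, 0) ∨
    (x.2 = 1 ∧ ∃ c, x.1 = OrderDual.toDual (colSet A c) ∧ (colSet A c).Nonempty) ∨
    (x.2 = 2 ∧ ∃ r, x.1 = OrderDual.toDual {r})}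

theorem lam_exists {n : ℕ} {κ : Type} (A : Fin n → κ → Bool)
    (hA : ∀ c d : κ, c ≠ d → ¬ Conflicted A c d) :
    ∃ (T : PhyloRootedTree) (leaf : Fin n → T.V)
      (node : ∀ c, (colSet A c).Nonempty → T.V),
      (∀ f, T.IsLeaf (leaf f)) ∧ Function.Injective leaf ∧
      (∀ c h, node c h ≠ T.root) ∧
      (∀ c h d h', T.Anc (node c h) (node d h') ↔ colSet A d ⊆ colSet A c) ∧
      (∀ c h d h', node c h = node d h' → colSet A c = colSet A d) ∧
      (∀ c h f, T.Anc (node c h) (leaf f) ↔ A f c = true) := by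
  classical
  let _ : PartialOrder (LamV A) := inferInstanceAs (PartialOrder (Subtype _))
  let _ : Fintype (LamV A) :=
    @Fintype.ofFinite _ (inferInstanceAs (Finite (Subtype _)))
  have lam : ∀ c d r, r ∈ colSet A c → r ∈ colSet A d →
      colSet A c ⊆ colSet A d ∨ colSet A d ⊆ colSet A c := by
    intro c d r hc hd
    by_contra hcon
    push Not at hcon
    obtain ⟨h1, h2⟩ := hcon
    obtain ⟨x, hx, hx'⟩ := Finset.not_subset.1 h1
    obtain ⟨y, hy, hy'⟩ := Finset.not_subset.1 h2
    rw [mem_colSet] at *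
    refine hA c d ?_ ⟨⟨y, by simpa using hy', hy⟩, ⟨x, hx, by simpa using hx'⟩, ⟨r, hc, hd⟩⟩
    rintro rfl
    exact hx' hx
  let b : LamV A := ⟨(OrderDual.toDual Finset.univ, 0), Or.inl rfl⟩
  have hle : ∀ x y : LamV A, x ≤ y ↔
      (OrderDual.ofDual y.1.1 ⊆ OrderDual.ofDual x.1.1 ∧ x.1.2 ≤ y.1.2) := fun x y => Iff.rfl
  have hb : ∀ x, b ≤ x := fun x => (hle _ _).2 ⟨Finset.subset_univ _, Fin.zero_le _⟩
  have hch : ∀ u v w : LamV A, u ≤ w → v ≤ w → u ≤ v ∨ v ≤ u := by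
    intro u v w hu hv
    by_cases hub : u = b
    · left; rw [hub]; exact hb v
    by_cases hvb : v = b
    · right; rw [hvb]; exact hb u
    have hleaf : ∀ u : LamV A, u ≤ w → u.1.2 = 2 → u = w := by
      rintro ⟨⟨s, i⟩, hs⟩ hu hi
      obtain ⟨⟨t, j⟩, ht⟩ := w
      replace hu := (hle _ _).1 hu
      simp only at hu hi
      subst hi
      have hj : j = 2 := (by decide : ∀ j : Fin 3, 2 ≤ j → j = 2) j hu.2
      subst hj
      simp at hs ht
      obtain ⟨r, rfl⟩ := hs
      obtain ⟨r', rfl⟩ := ht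
      simp at hu
      subst hu
      rfl
    by_cases hu2 : u.1.2 = 2
    · right; rw [hleaf u hu hu2]; exact hv
    by_cases hv2 : v.1.2 = 2
    · left; rw [hleaf v hv hv2]; exact hu
    have key : ∀ u : LamV A, u ≠ b → u.1.2 ≠ 2 → u.1.2 = 1 ∧
        ∃ c, u.1.1 = OrderDual.toDual (colSet A c) ∧ (colSet A c).Nonempty := by
      rintro ⟨x, h | h | h⟩ h1 h2
      · exact absurd (Subtype.ext h) h1
      · exact h
      · exact absurd h.1 h2
    obtain ⟨hu1, c, hc, -⟩ := key u hub hu2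
    obtain ⟨hv1, d, hd, -⟩ := key v hvb hv2
    rw [hle] at hu hv
    have hw : (OrderDual.ofDual w.1.1).Nonempty := by
      rcases w.2 with h | h | h
      · rw [h, hu1] at hu
        exact absurd (show (1 : Fin 3) ≤ 0 from hu.2) (by decide)
      · obtain ⟨_, e, he, h'⟩ := h
        rw [he]; exact h'
      · obtain ⟨_, e, he⟩ := h
        rw [he]; exact ⟨e, by simp⟩
    obtain ⟨r, hr⟩ := hw
    have hrc := hu.1 hr
    have hrd := hv.1 hr
    rw [hle, hle, hu1, hv1, hc, hd]
    rw [hc] at hrc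
    rw [hd] at hrd
    rcases lam c d r hrc hrd with h | h
    · right; exact ⟨h, le_rfl⟩
    · left; exact ⟨h, le_rfl⟩
  obtain ⟨p, hpb, hanc, hlt⟩ := exists_tree b hb hch
  refine ⟨⟨LamV A, inferInstance, b, p, hpb, fun v => (hanc v b).2 (hb v)⟩,
    fun f => ⟨(OrderDual.toDual {f}, 2), Or.inr (Or.inr ⟨rfl, f, rfl⟩)⟩,
    fun c h => ⟨(OrderDual.toDual (colSet A c), 1), Or.inr (Or.inl ⟨rfl, c, rfl, h⟩)⟩,
    ?_, ?_, ?_, ?_, ?_, ?_⟩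
  · intro f u hu
    change p u = _ at hu
    by_cases hub : u = b
    · rw [← hu, hub, hpb]
    · exfalso
      have h1 := hlt u hub
      rw [hu] at h1
      have h2 := (hle _ _).1 h1.le
      apply h1.ne
      rcases u.2 with h | h | h
      · exact absurd (Subtype.ext h) hub
      · rw [h.1] at h2
        exact absurd (show (2 : Fin 3) ≤ 1 from h2.2) (by decide)
      · obtain ⟨h3, r, hr⟩ := h
        apply Subtype.ext
        rw [hr] at h2
        have h4 : r = f := by simpa using h2.1
        exact Prod.ext (by rw [hr, h4]) h3.symm
  · intro f g hfg
    have := congrArg (fun x : LamV A => OrderDual.ofDual x.1.1) hfg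
    simpa using this
  · intro c h e
    have := congrArg (fun x : LamV A => x.1.2) e
    exact absurd (show (1 : Fin 3) = 0 from this) (by decide)
  · intro c h d h'
    refine (hanc _ _).trans ((hle _ _).trans ?_)
    exact and_iff_left le_rfl
  · intro c h d h' e
    exact congrArg (fun x : LamV A => OrderDual.ofDual x.1.1) e
  · intro c h f
    refine (hanc _ _).trans ((hle _ _).trans ?_)
    refine (and_iff_left (show (1 : Fin 3) ≤ 2 by decide)).trans ?_
    rw [← mem_colSet]
    exact Finset.singleton_subset_iff

/-- A binary matrix `M` can be represented by a persistent phylogeny iff there is a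
completion `M'` of the extended matrix `M_e` of `M` such that no pair of columns of
`M'` is conflicted. -/
theorem persistentPhylogeny_iff_completion_no_conflicted_pair
    (n m : ℕ) (M : Fin n → Fin m → Bool) :
    Nonempty (PersistentPhylogeny M) ↔
      ∃ M' : Fin n → Fin m × Bool → Bool,
        IsCompletion M M' ∧
          ∀ c d : Fin m × Bool, c ≠ d → ¬ Conflicted M' c d := by
  classical
  constructor
  · rintro ⟨P⟩
    let ev : Fin m × Bool → Option P.T.V := fun c => if c.2 then P.loss c.1 else P.gain c.1
    refine ⟨fun r c => decide (∃ u, ev c = some u ∧ P.T.Anc u (P.leaf r)), ?_, ?_⟩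
    · intro r j
      have hp := P.path_char r j
      refine ⟨fun h => ?_, fun h => ?_⟩
      · have h' := hp.1 h
        exact ⟨decide_eq_true h'.1, decide_eq_false h'.2⟩
      · rw [h] at hp
        refine decide_eq_decide.2 ⟨fun hg => ?_, ?_⟩
        · by_contra hl
          exact absurd (hp.2 ⟨hg, hl⟩) (by simp)
        · rintro ⟨v, hv, hvr⟩
          obtain ⟨u, hu, -, huv⟩ := P.loss_after_gain j v hv
          exact ⟨u, hu, anc_trans _ huv hvr⟩
    · rintro c d - ⟨⟨x, hx1, hx2⟩, ⟨y, hy1, hy2⟩, ⟨z, hz1, hz2⟩⟩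
      simp only [decide_eq_true_eq, decide_eq_false_iff_not] at *
      obtain ⟨u, hu, huz⟩ := hz1
      obtain ⟨v, hv, hvz⟩ := hz2
      rcases anc_total _ huz hvz with h | h
      · obtain ⟨v', hv', hvx⟩ := hx2
        rw [hv, Option.some.injEq] at hv'
        subst hv'
        exact hx1 ⟨u, hu, anc_trans _ h hvx⟩
      · obtain ⟨u', hu', huy⟩ := hy1
        rw [hu, Option.some.injEq] at hu'
        subst hu'
        exact hy2 ⟨v, hv, anc_trans _ h huy⟩
  · rintro ⟨M', hM, hconf⟩
    obtain ⟨T, leaf, node, h1, h2, h3, h4, h5, h6⟩ := lam_exists M' hconf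
    have hne : ∀ j, (∃ r, M r j = true) → (colSet M' (j, false)).Nonempty := by
      rintro j ⟨r, hr⟩
      exact ⟨r, (mem_colSet _ _ _).2 ((hM r j).1 hr).1⟩
    have hsub : ∀ j, colSet M' (j, true) ⊆ colSet M' (j, false) := by
      intro j r hr
      rw [mem_colSet] at *
      cases h : M r j
      · rw [(hM r j).2 h]; exact hr
      · exact ((hM r j).1 h).1
    let gain : Fin m → Option T.V := fun j =>
      if h : ∃ r, M r j = true then some (node (j, false) (hne j h)) else none
    let loss : Fin m → Option T.V := fun j =>
      if h : (∃ r, M r j = true) ∧ (colSet M' (j, true)).Nonempty then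
        some (node (j, true) h.2) else none
    have hg : ∀ j u, gain j = some u ↔
        ∃ h : ∃ r, M r j = true, node (j, false) (hne j h) = u := by
      intro j u
      by_cases h : ∃ r, M r j = true
      · simp only [gain, dif_pos h, Option.some.injEq]
        exact ⟨fun e => ⟨h, e⟩, fun e => e.2⟩
      · simp only [gain, dif_neg h]
        exact ⟨fun e => (by cases e), fun e => absurd e.1 h⟩
    have hl : ∀ j u, loss j = some u ↔
        ∃ h : (∃ r, M r j = true) ∧ (colSet M' (j, true)).Nonempty,
          node (j, true) h.2 = u := by
      intro j u
      by_cases h : (∃ r, M r j = true) ∧ (colSet M' (j, true)).Nonempty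
      · simp only [loss, dif_pos h, Option.some.injEq]
        exact ⟨fun e => ⟨h, e⟩, fun e => e.2⟩
      · simp only [loss, dif_neg h]
        exact ⟨fun e => (by cases e), fun e => absurd e.1 h⟩
    refine ⟨⟨T, leaf, h1, h2, gain, loss, ?_, ?_, ?_, ?_⟩⟩
    · intro c v h
      obtain ⟨_, rfl⟩ := (hg c v).1 h
      exact h3 _ _
    · intro c v h
      obtain ⟨_, rfl⟩ := (hl c v).1 h
      exact h3 _ _
    · intro c v h
      obtain ⟨⟨hr, hn⟩, rfl⟩ := (hl c v).1 h
      refine ⟨_, (hg c _).2 ⟨hr, rfl⟩, ?_, (h4 _ _ _ _).2 (hsub c)⟩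
      intro e
      have e' := h5 _ _ _ _ e
      obtain ⟨r, hr⟩ := hr
      have := (hM r c).1 hr
      have h7 := (mem_colSet M' (c, false) r).2 this.1
      rw [e', mem_colSet, this.2] at h7
      exact absurd h7 (by simp)
    · intro f c
      constructor
      · intro h
        have h' := (hM f c).1 h
        refine ⟨⟨_, (hg c _).2 ⟨⟨f, h⟩, rfl⟩, (h6 _ _ _).2 h'.1⟩, ?_⟩
        rintro ⟨v, hv, hvf⟩
        obtain ⟨_, rfl⟩ := (hl c v).1 hv
        rw [h6, h'.2] at hvf
        exact absurd hvf (by simp)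
      · rintro ⟨⟨u, hu, huf⟩, hn⟩
        obtain ⟨hr, rfl⟩ := (hg c u).1 hu
        rw [h6] at huf
        by_contra hc
        have hc' : M f c = false := by simpa using hc
        rw [(hM f c).2 hc'] at huf
        exact hn ⟨_, (hl c _).2 ⟨⟨hr, ⟨f, (mem_colSet _ _ _).2 huf⟩⟩, rfl⟩, (h6 _ _ _).2 huf⟩
end

section
/- Let M be an n×m binary matrix and let c be an unconflicted column of M, i.e., a column that is conflicted with no other column of M. Let M⁻ be the n×(m−1) binary matrix obtained from M by deleting column c. Then M has a persistent phylogeny if and only if M⁻ has a persistent phylogeny. -/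
namespace PhyloRootedTree

theorem anc_step (T : PhyloRootedTree) (u v : T.V) :
    T.Anc u v ↔ v = u ∨ T.Anc u (T.parent v) := by
  constructor
  · rintro ⟨k, hk⟩
    cases k with
    | zero => exact Or.inl hk
    | succ k => exact Or.inr ⟨k, by simpa [Function.iterate_succ_apply] using hk⟩
  · rintro (h | ⟨k, hk⟩)
    · exact ⟨0, h⟩
    · exact ⟨k + 1, by simpa [Function.iterate_succ_apply] using hk⟩

theorem anc_root (T : PhyloRootedTree) (u : T.V) : T.Anc u T.root ↔ u = T.root := by
  constructor
  · rintro ⟨k, hk⟩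
    rw [Function.iterate_fixed T.parent_root] at hk
    exact hk.symm
  · rintro rfl
    exact ⟨0, rfl⟩

theorem root_anc (T : PhyloRootedTree) (v : T.V) : T.Anc T.root v := T.reaches_root v

theorem rootInduction (T : PhyloRootedTree) (p : T.V → Prop) (h0 : p T.root)
    (hs : ∀ v, v ≠ T.root → p (T.parent v) → p v) (v : T.V) : p v := by
  obtain ⟨k, hk⟩ := T.reaches_root v
  induction k generalizing v with
  | zero => exact (show v = T.root from hk) ▸ h0
  | succ k ih =>
    by_cases hv : v = T.root
    · exact hv ▸ h0
    · exact hs v hv (ih _ (by simpa [Function.iterate_succ_apply] using hk))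

open Classical in
/-- parent function of the doubled tree -/
noncomputable def dblParent (T : PhyloRootedTree) (x : T.V) : T.V ⊕ T.V → T.V ⊕ T.V
  | Sum.inl v => Sum.inl (T.parent v)
  | Sum.inr v => if v = T.root then Sum.inl x else Sum.inr (T.parent v)

theorem dblParent_iter_inl (T : PhyloRootedTree) (x : T.V) (k : ℕ) (v : T.V) :
    (T.dblParent x)^[k] (Sum.inl v) = Sum.inl (T.parent^[k] v) := by
  induction k generalizing v with
  | zero => rfl
  | succ k ih => simp only [Function.iterate_succ_apply, dblParent, ih]

theorem dblParent_inr_root (T : PhyloRootedTree) (x : T.V) :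
    T.dblParent x (Sum.inr T.root) = Sum.inl x := by simp [dblParent]

theorem dblParent_inr (T : PhyloRootedTree) (x : T.V) (v : T.V) (hv : v ≠ T.root) :
    T.dblParent x (Sum.inr v) = Sum.inr (T.parent v) := by simp [dblParent, hv]

/-- `T` with a second copy of itself hung below `x` -/
noncomputable def dbl (T : PhyloRootedTree) (x : T.V) : PhyloRootedTree where
  V := T.V ⊕ T.V
  fin := letI := T.fin; inferInstance
  root := Sum.inl T.root
  parent := T.dblParent x
  parent_root := by simp [dblParent, T.parent_root]
  reaches_root := by
    have hl : ∀ v, ∃ k, (T.dblParent x)^[k] (Sum.inl v) = Sum.inl T.root := fun v => by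
      obtain ⟨k, hk⟩ := T.reaches_root v
      exact ⟨k, by rw [dblParent_iter_inl, hk]⟩
    rintro (v | v)
    · exact hl v
    · refine T.rootInduction
        (fun v => ∃ k, (T.dblParent x)^[k] (Sum.inr v) = Sum.inl T.root) ?_ ?_ v
      · obtain ⟨k, hk⟩ := hl x
        exact ⟨k + 1, by rw [Function.iterate_succ_apply, dblParent_inr_root, hk]⟩
      · rintro v hv ⟨k, hk⟩
        exact ⟨k + 1, by rw [Function.iterate_succ_apply, dblParent_inr _ _ _ hv, hk]⟩

theorem dbl_ll (T : PhyloRootedTree) (x u v : T.V) :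
    (T.dbl x).Anc (Sum.inl u : T.V ⊕ T.V) (Sum.inl v : T.V ⊕ T.V) ↔ T.Anc u v := by
  refine exists_congr fun k => ?_
  change (T.dblParent x)^[k] (Sum.inl v) = Sum.inl u ↔ _
  rw [dblParent_iter_inl, Sum.inl.injEq]

theorem dbl_rl (T : PhyloRootedTree) (x u v : T.V) :
    ¬ (T.dbl x).Anc (Sum.inr u : T.V ⊕ T.V) (Sum.inl v : T.V ⊕ T.V) := by
  rintro ⟨k, hk⟩
  change (T.dblParent x)^[k] (Sum.inl v) = Sum.inr u at hk
  rw [dblParent_iter_inl] at hk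
  cases hk

theorem dbl_step_root (T : PhyloRootedTree) (x : T.V) (w : T.V ⊕ T.V) :
    (T.dbl x).Anc w (Sum.inr T.root : T.V ⊕ T.V) ↔
      (Sum.inr T.root : T.V ⊕ T.V) = w ∨ (T.dbl x).Anc w (Sum.inl x : T.V ⊕ T.V) := by
  rw [← dblParent_inr_root]
  exact (T.dbl x).anc_step _ _

theorem dbl_step (T : PhyloRootedTree) (x : T.V) (w : T.V ⊕ T.V) (v : T.V) (hv : v ≠ T.root) :
    (T.dbl x).Anc w (Sum.inr v : T.V ⊕ T.V) ↔
      (Sum.inr v : T.V ⊕ T.V) = w ∨ (T.dbl x).Anc w (Sum.inr (T.parent v) : T.V ⊕ T.V) := by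
  rw [← dblParent_inr T x v hv]
  exact (T.dbl x).anc_step _ _

theorem dbl_lr (T : PhyloRootedTree) (x u v : T.V) :
    (T.dbl x).Anc (Sum.inl u : T.V ⊕ T.V) (Sum.inr v : T.V ⊕ T.V) ↔ T.Anc u x := by
  refine T.rootInduction (fun v =>
    (T.dbl x).Anc (Sum.inl u : T.V ⊕ T.V) (Sum.inr v : T.V ⊕ T.V) ↔ T.Anc u x) ?_ ?_ v
  · rw [dbl_step_root, dbl_ll]; simp
  · intro v hv ih
    rw [dbl_step _ _ _ _ hv, ih]; simp

theorem dbl_rr (T : PhyloRootedTree) (x u v : T.V) :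
    (T.dbl x).Anc (Sum.inr u : T.V ⊕ T.V) (Sum.inr v : T.V ⊕ T.V) ↔ T.Anc u v := by
  refine T.rootInduction (fun v =>
    (T.dbl x).Anc (Sum.inr u : T.V ⊕ T.V) (Sum.inr v : T.V ⊕ T.V) ↔ T.Anc u v) ?_ ?_ v
  · rw [dbl_step_root, anc_root]; simp [dbl_rl, eq_comm]
  · intro v hv ih
    rw [dbl_step _ _ _ _ hv, ih, T.anc_step u v]; simp

end PhyloRootedTree

open Classical in
theorem phylo_extend {n m : ℕ} (M : Fin n → Fin m → Bool) (c : Fin m)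
    (hc : ∀ d : Fin m, d ≠ c → ¬ Conflicted M c d)
    (P : PersistentPhylogeny (fun (r : Fin n) (d : {d : Fin m // d ≠ c}) => M r d.val))
    (x : Fin n) (hx : M x c = true) : Nonempty (PersistentPhylogeny M) := by
  let ins : Fin m → Prop := fun d => ∀ r, M r d = true → M r c = true
  have hout : ∀ d, d ≠ c → ¬ ins d → ∀ f, M f c = true → (M f d = true ↔ M x d = true) := by
    intro d hd hi f hf
    have h := hc d hd
    simp only [ins, not_forall] at hi
    obtain ⟨r, hr, hr'⟩ := hi
    have h1 : ∃ r, M r c = false ∧ M r d = true := ⟨r, by simpa using hr', hr⟩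
    constructor
    · intro hfd
      by_contra hxd
      exact h ⟨h1, ⟨x, hx, by simpa using hxd⟩, ⟨f, hf, hfd⟩⟩
    · intro hxd
      by_contra hfd
      exact h ⟨h1, ⟨f, hf, by simpa using hfd⟩, ⟨x, hx, hxd⟩⟩
  let T := P.T
  let emb : Fin m → T.V → T.V ⊕ T.V := fun d v => if ins d then Sum.inr v else Sum.inl v
  let gain : Fin m → Option (T.V ⊕ T.V) := fun d =>
    if h : d = c then some (Sum.inr T.root) else (P.gain ⟨d, h⟩).map (emb d)
  let loss : Fin m → Option (T.V ⊕ T.V) := fun d =>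
    if h : d = c then none else (P.loss ⟨d, h⟩).map (emb d)
  let leaf : Fin n → T.V ⊕ T.V := fun f =>
    if M f c = true then Sum.inr (P.leaf f) else Sum.inl (P.leaf f)
  have embAnc : ∀ d u v, T.Anc u v → (T.dbl (P.leaf x)).Anc (emb d u) (emb d v) := by
    intro d u v h
    by_cases hi : ins d
    · simp only [emb, if_pos hi]; exact (T.dbl_rr _ _ _).2 h
    · simp only [emb, if_neg hi]; exact (T.dbl_ll _ _ _).2 h
  have embInj : ∀ d, Function.Injective (emb d) := by
    intro d u v h
    by_cases hi : ins d
    · simpa [emb, hi] using h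
    · simpa [emb, hi] using h
  have embRoot : ∀ d v, v ≠ T.root → emb d v ≠ Sum.inl T.root := by
    intro d v h
    by_cases hi : ins d
    · simp [emb, hi]
    · simpa [emb, hi] using h
  refine ⟨{ T := T.dbl (P.leaf x), leaf := leaf, gain := gain, loss := loss,
            leaf_isLeaf := ?_, leaf_inj := ?_, gain_ne_root := ?_, loss_ne_root := ?_,
            loss_after_gain := ?_, path_char := ?_ }⟩
  · intro f u hu
    change T.dblParent (P.leaf x) u = leaf f at hu
    change u = leaf f
    by_cases hf : M f c = true
    · simp only [leaf, if_pos hf] at hu ⊢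
      rcases u with u | u
      · simp [PhyloRootedTree.dblParent] at hu
      · by_cases hr : u = T.root
        · subst hr; rw [T.dblParent_inr_root] at hu; cases hu
        · rw [T.dblParent_inr _ _ hr] at hu
          exact congrArg _ (P.leaf_isLeaf f u (Sum.inr.inj hu))
    · simp only [leaf, if_neg hf] at hu ⊢
      rcases u with u | u
      · exact congrArg _ (P.leaf_isLeaf f u (Sum.inl.inj hu))
      · by_cases hr : u = T.root
        · subst hr; rw [T.dblParent_inr_root] at hu
          exact absurd (P.leaf_inj (Sum.inl.inj hu) ▸ hx) hf
        · rw [T.dblParent_inr _ _ hr] at hu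
          cases hu
  · intro f g h
    apply P.leaf_inj
    simp only [leaf] at h
    split_ifs at h
    · exact Sum.inr.inj h
    · exact Sum.inl.inj h
  · intro d (v : T.V ⊕ T.V) (h : gain d = some v)
    change (v : T.V ⊕ T.V) ≠ Sum.inl T.root
    by_cases hd : d = c
    · simp only [gain, dif_pos hd, Option.some.injEq] at h
      rw [← h]; simp
    · simp only [gain, dif_neg hd, Option.map_eq_some_iff] at h
      obtain ⟨w, hw, rfl⟩ := h
      exact embRoot d w (P.gain_ne_root _ _ hw)
  · intro d (v : T.V ⊕ T.V) (h : loss d = some v)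
    change (v : T.V ⊕ T.V) ≠ Sum.inl T.root
    by_cases hd : d = c
    · simp [loss, dif_pos hd] at h
    · simp only [loss, dif_neg hd, Option.map_eq_some_iff] at h
      obtain ⟨w, hw, rfl⟩ := h
      exact embRoot d w (P.loss_ne_root _ _ hw)
  · intro d (v : T.V ⊕ T.V) (h : loss d = some v)
    by_cases hd : d = c
    · simp [loss, dif_pos hd] at h
    · simp only [loss, dif_neg hd, Option.map_eq_some_iff] at h
      obtain ⟨w, hw, rfl⟩ := h
      obtain ⟨u, hu, huw, hanc⟩ := P.loss_after_gain _ _ hw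
      refine ⟨emb d u, ?_, fun h => huw (embInj d h), embAnc d u w hanc⟩
      simp only [gain, dif_neg hd, hu, Option.map_some]
      rfl
  · intro f d
    by_cases hd : d = c
    · subst hd
      have hg : gain d = some (Sum.inr T.root) := dif_pos rfl
      have hl : loss d = none := dif_pos rfl
      have hA : M f d = true ↔
          (T.dbl (P.leaf x)).Anc (Sum.inr T.root : T.V ⊕ T.V) (leaf f) := by
        by_cases hf : M f d = true
        · simp only [leaf, if_pos hf]
          exact iff_of_true hf ((T.dbl_rr _ _ _).2 (T.root_anc _))
        · simp only [leaf, if_neg hf]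
          exact iff_of_false hf (T.dbl_rl _ _ _)
      rw [hg, hl, hA]
      constructor
      · intro h
        exact ⟨⟨_, rfl, h⟩, by rintro ⟨v, hv, -⟩; cases hv⟩
      · rintro ⟨⟨u, hu, h⟩, -⟩
        cases hu
        exact h
    · -- the vertex of `T` whose path determines `d` at `f`
      have key : ∀ o : Option T.V,
          (∃ u, o.map (emb d) = some u ∧ (T.dbl (P.leaf x)).Anc u (leaf f)) ↔
          ∃ u, o = some u ∧ (T.dbl (P.leaf x)).Anc (emb d u) (leaf f) := by
        intro o
        cases o <;> simp
      have hg : gain d = (P.gain ⟨d, hd⟩).map (emb d) := dif_neg hd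
      have hl : loss d = (P.loss ⟨d, hd⟩).map (emb d) := dif_neg hd
      have hPf := P.path_char f ⟨d, hd⟩
      have hPx := P.path_char x ⟨d, hd⟩
      have goal' : M f d = true ↔
        ((∃ u, P.gain ⟨d, hd⟩ = some u ∧ (T.dbl (P.leaf x)).Anc (emb d u) (leaf f)) ∧
        ¬ (∃ u, P.loss ⟨d, hd⟩ = some u ∧ (T.dbl (P.leaf x)).Anc (emb d u) (leaf f))) := by
        by_cases hi : ins d <;> by_cases hf : M f c = true
        · simp only [emb, leaf, if_pos hi, if_pos hf, T.dbl_rr]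
          exact hPf
        · simp only [emb, leaf, if_pos hi, if_neg hf, T.dbl_rl, and_false, exists_false, false_and,
            iff_false]
          exact fun h => hf (hi f h)
        · simp only [emb, leaf, if_neg hi, if_pos hf, T.dbl_lr]
          exact (hout d hd hi f hf).trans hPx
        · simp only [emb, leaf, if_neg hi, if_neg hf, T.dbl_ll]
          exact hPf
      rw [hg, hl]
      exact goal'.trans (and_congr (key _).symm (not_congr (key _).symm))

/-- Removing an unconflicted column does not affect the existence of a persistent
phylogeny: if column `c` of `M` is conflicted with no other column, then `M` has a
persistent phylogeny iff the matrix obtained from `M` by deleting column `c` has one. -/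
theorem persistentPhylogeny_iff_deleteUnconflictedColumn
    (n m : ℕ) (M : Fin n → Fin m → Bool) (c : Fin m)
    (hc : ∀ d : Fin m, d ≠ c → ¬ Conflicted M c d) :
    Nonempty (PersistentPhylogeny M) ↔
      Nonempty (PersistentPhylogeny
        (fun (r : Fin n) (d : {d : Fin m // d ≠ c}) => M r d.val)) := by
  constructor
  · rintro ⟨P⟩
    exact ⟨{ T := P.T, leaf := P.leaf, leaf_isLeaf := P.leaf_isLeaf, leaf_inj := P.leaf_inj,
             gain := fun d => P.gain d.val, loss := fun d => P.loss d.val,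
             gain_ne_root := fun d => P.gain_ne_root d.val,
             loss_ne_root := fun d => P.loss_ne_root d.val,
             loss_after_gain := fun d => P.loss_after_gain d.val,
             path_char := fun f d => P.path_char f d.val }⟩
  · rintro ⟨P⟩
    by_cases hx : ∃ x, M x c = true
    · obtain ⟨x, hx⟩ := hx
      exact phylo_extend M c hc P x hx
    · push Not at hx
      refine ⟨{ T := P.T, leaf := P.leaf, leaf_isLeaf := P.leaf_isLeaf, leaf_inj := P.leaf_inj,
                gain := fun d => if h : d = c then none else P.gain ⟨d, h⟩,
                loss := fun d => if h : d = c then none else P.loss ⟨d, h⟩,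
                gain_ne_root := ?_, loss_ne_root := ?_, loss_after_gain := ?_, path_char := ?_ }⟩
      · intro d v h
        by_cases hd : d = c
        · simp [hd] at h
        · simp only [dif_neg hd] at h; exact P.gain_ne_root _ _ h
      · intro d v h
        by_cases hd : d = c
        · simp [hd] at h
        · simp only [dif_neg hd] at h; exact P.loss_ne_root _ _ h
      · intro d v h
        by_cases hd : d = c
        · simp [hd] at h
        · simp only [dif_neg hd] at h ⊢; exact P.loss_after_gain _ _ h
      · intro f d
        by_cases hd : d = c
        · simp [hd, hx f]
        · simp only [dif_neg hd]; exact P.path_char f ⟨d, hd⟩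
end

section
/- If an n×m binary matrix M can be represented by a galled tree, then there is a completion M'_e of the extended matrix M_e of M such that no pair of columns of M'_e is conflicted. -/
section TreePart

def Below {V : Type} (f : V → V) (u w : V) : Prop := ∃ k, f^[k] w = u

lemma Below.rfl' {V : Type} (f : V → V) (u : V) : Below f u u := ⟨0, rfl⟩

lemma Below.trans' {V : Type} {f : V → V} {a b c : V} (h1 : Below f a b) (h2 : Below f b c) :
    Below f a c := by
  obtain ⟨k, rfl⟩ := h1
  obtain ⟨l, rfl⟩ := h2
  exact ⟨k + l, by rw [Function.iterate_add_apply]⟩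

lemma Below.step {V : Type} {f : V → V} {u w : V} (h : Below f u w) (hne : w ≠ u) :
    Below f u (f w) := by
  obtain ⟨k, hk⟩ := h
  cases k with
  | zero => exact absurd hk hne
  | succ k => exact ⟨k, by rw [← hk, Function.iterate_succ_apply]⟩

lemma Below.up {V : Type} {f : V → V} {u w : V} (h : Below f u (f w)) : Below f u w := by
  obtain ⟨k, hk⟩ := h
  exact ⟨k + 1, by rw [← hk, Function.iterate_succ_apply]⟩

lemma Below.total {V : Type} {f : V → V} {a b w : V} (h1 : Below f a w) (h2 : Below f b w) :
    Below f a b ∨ Below f b a := by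
  obtain ⟨k, rfl⟩ := h1
  obtain ⟨l, rfl⟩ := h2
  rcases le_total k l with h | h
  · right
    refine ⟨l - k, ?_⟩
    rw [← Function.iterate_add_apply]; congr 2; omega
  · left
    refine ⟨k - l, ?_⟩
    rw [← Function.iterate_add_apply]; congr 2; omega

def Lam {V : Type} (f : V → V) (X : Set V) : Prop := X = ∅ ∨ ∃ u, X = {w | Below f u w}

lemma Lam.laminar {V : Type} {f : V → V} {X Y : Set V} (hX : Lam f X) (hY : Lam f Y)
    {w : V} (h1 : w ∈ X) (h2 : w ∈ Y) : X ⊆ Y ∨ Y ⊆ X := by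
  rcases hX with rfl | ⟨u, rfl⟩
  · exact absurd h1 (by simp)
  rcases hY with rfl | ⟨v, rfl⟩
  · exact absurd h2 (by simp)
  rcases Below.total h1 h2 with h | h
  · right; intro z hz; exact h.trans' hz
  · left; intro z hz; exact h.trans' hz

lemma Below.depth {V : Type} {f : V → V} {root : V} (hroot : f root = root) {h : V → ℕ}
    (hh : ∀ w, w ≠ root → h (f w) < h w) {u w : V} (hb : Below f u w) : w = u ∨ h u < h w := by
  obtain ⟨k, rfl⟩ := hb
  induction k generalizing w with
  | zero => left; rfl
  | succ k ih =>
    rw [Function.iterate_succ_apply]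
    by_cases hw : w = root
    · left; subst hw; rw [hroot]; exact (Function.iterate_fixed hroot k).symm
    · right
      rcases @ih (f w) with h1 | h1
      · rw [← h1]; exact hh w hw
      · exact h1.trans (hh w hw)

lemma tree_part {V : Type} (f : V → V) (root : V) (hroot : f root = root)
    (hreach : ∀ w, ∃ k, f^[k] w = root) (χ : V → Bool) (hχ : χ root = false) (α β : V)
    (hαβ : Below f α β)
    (hch : ∀ w, w ≠ root → χ w ≠ χ (f w) → w = α ∨ w = β) :
    ∃ A B : Set V, Lam f A ∧ Lam f B ∧ B ⊆ A ∧ ∀ w, χ w = true ↔ (w ∈ A ∧ w ∉ B) := by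
  classical
  obtain ⟨h, hh⟩ : ∃ h : V → ℕ, ∀ w, w ≠ root → h (f w) < h w := by
    refine ⟨fun w => Nat.find (hreach w), ?_⟩
    intro w hw
    have hs := Nat.find_spec (hreach w)
    have hpos : Nat.find (hreach w) ≠ 0 := by
      intro h0; rw [h0] at hs; exact hw hs
    obtain ⟨k, hk⟩ := Nat.exists_eq_succ_of_ne_zero hpos
    have : Nat.find (hreach (f w)) ≤ k := by
      apply Nat.find_min'
      rw [hk, Function.iterate_succ_apply] at hs; exact hs
    show Nat.find (hreach (f w)) < Nat.find (hreach w)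
    omega
  have hrb : ∀ u, Below f u root → root = u := by
    rintro u ⟨k, rfl⟩
    exact (Function.iterate_fixed hroot k).symm
  have h1 : ∀ n w, h w = n → Below f β w → χ w = χ β := by
    intro n
    induction n using Nat.strong_induction_on with
    | _ n ih =>
      intro w hn hb
      by_cases hwβ : w = β
      · rw [hwβ]
      by_cases hwr : w = root
      · subst hwr; exact absurd (hrb _ hb) hwβ
      have hwα : w ≠ α := by
        rintro rfl
        rcases hb.depth hroot hh with e | e
        · exact hwβ e
        · rcases hαβ.depth hroot hh with e' | e'
          · exact hwβ e'.symm
          · omega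
      have e : χ w = χ (f w) := by
        by_contra hc
        rcases hch w hwr hc with e | e
        · exact hwα e
        · exact hwβ e
      rw [e]
      exact ih _ (hn ▸ hh w hwr) _ rfl (hb.step hwβ)
  have h2 : ∀ n w, h w = n → Below f α w → ¬ Below f β w → χ w = χ α := by
    intro n
    induction n using Nat.strong_induction_on with
    | _ n ih =>
      intro w hn hb hnb
      by_cases hwα : w = α
      · rw [hwα]
      by_cases hwr : w = root
      · subst hwr; exact absurd (hrb _ hb) hwα
      have hwβ : w ≠ β := by
        rintro rfl; exact hnb (Below.rfl' f _)
      have e : χ w = χ (f w) := by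
        by_contra hc
        rcases hch w hwr hc with e | e
        · exact hwα e
        · exact hwβ e
      rw [e]
      exact ih _ (hn ▸ hh w hwr) _ rfl (hb.step hwα) (fun h => hnb h.up)
  have h3 : ∀ n w, h w = n → ¬ Below f α w → χ w = false := by
    intro n
    induction n using Nat.strong_induction_on with
    | _ n ih =>
      intro w hn hnb
      by_cases hwr : w = root
      · subst hwr; exact hχ
      have hwα : w ≠ α := by
        rintro rfl; exact hnb (Below.rfl' f _)
      have hwβ : w ≠ β := by
        rintro rfl; exact hnb hαβ
      have e : χ w = χ (f w) := by
        by_contra hc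
        rcases hch w hwr hc with e | e
        · exact hwα e
        · exact hwβ e
      rw [e]
      exact ih _ (hn ▸ hh w hwr) _ rfl (fun h => hnb h.up)
  have hsub : {w | Below f β w} ⊆ {w | Below f α w} := fun w hw => hαβ.trans' hw
  have key : ∀ w, χ w = if Below f β w then χ β else if Below f α w then χ α else false := by
    intro w
    split_ifs with a b
    · exact h1 _ w rfl a
    · exact h2 _ w rfl b a
    · exact h3 _ w rfl b
  have hs : ∀ w, Below f β w → Below f α w := fun w hw => hαβ.trans' hw
  cases ea : χ α <;> cases eb : χ β
  · refine ⟨∅, ∅, Or.inl rfl, Or.inl rfl, subset_rfl, fun w => ?_⟩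
    rw [key, ea, eb]; simp
  · refine ⟨{w | Below f β w}, ∅, Or.inr ⟨_, rfl⟩, Or.inl rfl, by simp, fun w => ?_⟩
    rw [key, ea, eb]; simp
  · refine ⟨{w | Below f α w}, {w | Below f β w}, Or.inr ⟨_, rfl⟩, Or.inr ⟨_, rfl⟩, hsub, fun w => ?_⟩
    rw [key, ea, eb]; simp; tauto
  · refine ⟨{w | Below f α w}, ∅, Or.inr ⟨_, rfl⟩, Or.inl rfl, by simp, fun w => ?_⟩
    rw [key, ea, eb]; have := hs w; simp; tauto

end TreePart

section CyclePart

lemma walk_of_fun {V : Type} (G : SimpleGraph V) (g : ℕ → V) (n : ℕ)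
    (hg : ∀ i < n, G.Adj (g i) (g (i + 1))) :
    ∃ p : G.Walk (g 0) (g n), p.support = (List.range (n + 1)).map g ∧
      p.edges = (List.range n).map (fun i => s(g i, g (i + 1))) := by
  induction n with
  | zero => exact ⟨SimpleGraph.Walk.nil, by simp, by simp⟩
  | succ n ih =>
    obtain ⟨p, hp, he⟩ := ih (fun i hi => hg i (by omega))
    refine ⟨p.concat (hg n (by omega)), ?_, ?_⟩
    · rw [SimpleGraph.Walk.support_concat, hp, List.range_succ (n := n + 1)]; simp
    · rw [SimpleGraph.Walk.edges_concat, he, List.range_succ (n := n)]; simp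

lemma cycle_of_fun {V : Type} (G : SimpleGraph V) (g : ℕ → V) (n : ℕ) (hn : 2 ≤ n)
    (hg : ∀ i ≤ n, G.Adj (g i) (g (i + 1))) (hcl : g (n + 1) = g 0)
    (inj : ∀ i ≤ n, ∀ j ≤ n, g i = g j → i = j) :
    ∃ p : G.Walk (g n) (g n), p.IsCycle ∧ ∀ v, v ∈ p.support ↔ ∃ i ≤ n, g i = v := by
  obtain ⟨p, hp, he⟩ := walk_of_fun G g n (fun i hi => hg i hi.le)
  have hadj : G.Adj (g n) (g 0) := by rw [← hcl]; exact hg n le_rfl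
  refine ⟨SimpleGraph.Walk.cons hadj p, ?_, ?_⟩
  · rw [SimpleGraph.Walk.cons_isCycle_iff]
    constructor
    · rw [SimpleGraph.Walk.isPath_def, hp]
      refine List.Nodup.map_on ?_ List.nodup_range
      intro x hx y hy
      simp at hx hy
      exact inj x (by omega) y (by omega)
    · rw [he]
      simp only [List.mem_map, List.mem_range, not_exists, not_and]
      intro i hi h
      rw [Sym2.eq_iff] at h
      rcases h with ⟨h1, h2⟩ | ⟨h1, h2⟩
      · have := inj _ (by omega) _ (by omega) h1; omega
      · have := inj _ (by omega) _ (by omega) h1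
        have := inj _ (by omega) _ (by omega) h2; omega
  · intro v
    rw [SimpleGraph.Walk.support_cons, hp]
    simp only [List.mem_cons, List.mem_map, List.mem_range]
    constructor
    · rintro (h | ⟨i, hi, h⟩)
      · exact ⟨n, le_rfl, h.symm⟩
      · exact ⟨i, by omega, h⟩
    · rintro ⟨i, hi, h⟩
      exact Or.inr ⟨i, by omega, h⟩

lemma path_fun {V : Type} {E : V → V → Prop} {a b : V} (h : Relation.ReflTransGen E a b) :
    ∃ (k : ℕ) (u : ℕ → V), u 0 = a ∧ u k = b ∧ ∀ i < k, E (u i) (u (i + 1)) := by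
  induction h with
  | refl => exact ⟨0, fun _ => a, rfl, rfl, by simp⟩
  | @tail b c _ hbc ih =>
    obtain ⟨k, u, h0, hk, hu⟩ := ih
    refine ⟨k + 1, fun i => if i ≤ k then u i else c, by simp [h0], by simp, ?_⟩
    intro i hi
    by_cases hik : i = k
    · subst hik; simp [hk, hbc]
    · have : i + 1 ≤ k := by omega
      simp only [this, if_true, show i ≤ k by omega]
      exact hu i (by omega)

lemma rank_mono {V : Type} {E : V → V → Prop} {rank : V → ℕ}
    (hE : ∀ u v, E u v → rank u < rank v) {k : ℕ} {u : ℕ → V}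
    (hu : ∀ i < k, E (u i) (u (i + 1))) (i j : ℕ) (hij : i ≤ j) (hj : j ≤ k) :
    rank (u i) + (j - i) ≤ rank (u j) := by
  induction j, hij using Nat.le_induction with
  | base => simp
  | succ j hij ih =>
    have := ih (by omega)
    have := hE _ _ (hu j (by omega))
    omega

/-- gall data -/
structure GallData {V : Type} (E : V → V → Prop) (x : V) (g : ℕ → V) (t l : ℕ) : Prop where
  ht : 1 ≤ t
  htl : t ≤ l
  hl : 2 ≤ l
  hx : g t = x
  up : ∀ i < t, E (g i) (g (i + 1))
  down : ∀ i, t ≤ i → i ≤ l → E (g (i + 1)) (g i)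
  inj : ∀ i ≤ l, ∀ j ≤ l, g i = g j → i = j
  cl : g (l + 1) = g 0

lemma exists_gall {V : Type} {E : V → V → Prop} {rank : V → ℕ} {root : V}
    (hE : ∀ u v, E u v → rank u < rank v) (reach : ∀ v, Relation.ReflTransGen E root v)
    {x p q : V} (hpq : p ≠ q) (hp : E p x) (hq : E q x) :
    ∃ g t l, GallData E x g t l := by
  classical
  obtain ⟨k, u, hu0, huk, hu⟩ := path_fun (reach p)
  obtain ⟨k', w, hw0, hwk, hw⟩ := path_fun (reach q)
  let P : ℕ → Prop := fun i => i ≤ k ∧ ∃ j ≤ k', u i = w j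
  have hP0 : P 0 := ⟨by omega, 0, by omega, by rw [hu0, hw0]⟩
  have hPi : P (Nat.findGreatest P k) := Nat.findGreatest_spec (Nat.zero_le k) hP0
  have hmax : ∀ n, n ≤ k → P n → n ≤ Nat.findGreatest P k := fun n hn h => Nat.le_findGreatest hn h
  generalize Nat.findGreatest P k = i at hPi hmax
  obtain ⟨hik, j, hj, hij⟩ := hPi
  have ru := rank_mono hE hu
  have rw' := rank_mono hE hw
  have rp := hE _ _ hp
  have rq := hE _ _ hq
  have uinj : ∀ a ≤ k, ∀ b ≤ k, u a = u b → a = b := by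
    intro a ha b hb h
    rcases le_total a b with hab | hab
    · have := ru a b hab hb; rw [h] at this; omega
    · have := ru b a hab ha; rw [h] at this; omega
  have winj : ∀ a ≤ k', ∀ b ≤ k', w a = w b → a = b := by
    intro a ha b hb h
    rcases le_total a b with hab | hab
    · have := rw' a b hab hb; rw [h] at this; omega
    · have := rw' b a hab ha; rw [h] at this; omega
  have ux : ∀ a ≤ k, u a ≠ x := by
    intro a ha h
    have := ru a k ha le_rfl; rw [h, huk] at this; omega
  have wx : ∀ a ≤ k', w a ≠ x := by
    intro a ha h
    have := rw' a k' ha le_rfl; rw [h, hwk] at this; omega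
  have uw : ∀ a, i ≤ a → a ≤ k → ∀ b, j < b → b ≤ k' → u a ≠ w b := by
    intro a ha hak b hb hbk h
    have := hmax a hak ⟨hak, b, hbk, h⟩
    have : a = i := by omega
    subst this
    rw [hij] at h
    have := winj _ hj _ hbk h
    omega
  obtain ⟨t, ht⟩ : ∃ t, t = k - i + 1 := ⟨_, rfl⟩
  obtain ⟨l, hl⟩ : ∃ l, l = t + (k' - j) := ⟨_, rfl⟩
  let g : ℕ → V := fun n => if n < t then u (i + n) else if n = t then x else w (k' + t + 1 - n)
  have g1 : ∀ n, n < t → g n = u (i + n) := fun n hn => by simp [g, hn]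
  have g2 : g t = x := by simp [g]
  have g3 : ∀ n, t < n → g n = w (k' + t + 1 - n) := fun n hn => by
    simp [g, show ¬ n < t by omega, show n ≠ t by omega]
  refine ⟨g, t, l, ?_⟩
  refine ⟨by omega, by omega, ?_, g2, ?_, ?_, ?_, ?_⟩
  · by_contra hc
    have e1 : i = k := by omega
    have e2 : j = k' := by omega
    subst e1; subst e2
    exact hpq (by rw [← huk, hij, hwk])
  · intro n hn
    by_cases h : n + 1 = t
    · rw [g1 n hn, h, g2, show i + n = k by omega, huk]; exact hp
    · rw [g1 n hn, g1 (n + 1) (by omega)]; exact hu _ (by omega)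
  · intro n hn hnl
    by_cases h : n = t
    · rw [h, g2, g3 _ (by omega), show k' + t + 1 - (t + 1) = k' by omega, hwk]; exact hq
    · rw [g3 _ (by omega), g3 n (by omega)]
      have := hw (k' + t + 1 - (n + 1)) (by omega)
      rwa [show k' + t + 1 - (n + 1) + 1 = k' + t + 1 - n by omega] at this
  · have sym : ∀ a b, a < b → b ≤ l → g a ≠ g b := by
      intro a b hab hb
      rcases lt_trichotomy a t with h | h | h
      · rw [g1 a h]
        rcases lt_trichotomy b t with h' | h' | h'
        · rw [g1 b h']
          intro e
          have := uinj _ (by omega) _ (by omega) e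
          omega
        · rw [h', g2]; exact ux _ (by omega)
        · rw [g3 b h']; exact uw _ (by omega) (by omega) _ (by omega) (by omega)
      · rw [h, g2, g3 b (by omega)]; exact (wx _ (by omega)).symm
      · rw [g3 a h, g3 b (by omega)]
        intro e
        have := winj _ (by omega) _ (by omega) e
        omega
    intro a ha b hb e
    rcases lt_trichotomy a b with h | h | h
    · exact absurd e (sym a b h hb)
    · exact h
    · exact absurd e.symm (sym b a h ha)
  · rw [g3 _ (by omega), g1 0 (by omega), show k' + t + 1 - (l + 1) = j by omega, ← hij]; rfl

lemma GallData.rank_le {V : Type} {E : V → V → Prop} {rank : V → ℕ}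
    (hE : ∀ u v, E u v → rank u < rank v) {x : V} {g : ℕ → V} {t l : ℕ}
    (G : GallData E x g t l) (i : ℕ) (hi : i ≤ l) :
    rank (g i) ≤ rank x ∧ (rank (g i) = rank x → i = t) ∧ (1 ≤ i → rank (g 0) < rank (g i)) := by
  have a := rank_mono hE G.up
  have b : ∀ d, t + d ≤ l + 1 → rank (g (t + d)) + d ≤ rank x := by
    intro d
    induction d with
    | zero => intro _; simp [G.hx]
    | succ d ih =>
      intro h
      have := ih (by omega)
      have h2 := hE _ _ (G.down (t + d) (by omega) (by omega))
      rw [show t + (d + 1) = t + d + 1 by omega]; omega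
  have c : ∀ d, t + d ≤ l + 1 → rank (g (l + 1)) + d ≤ rank (g (l + 1 - d)) := by
    intro d
    induction d with
    | zero => intro _; simp
    | succ d ih =>
      intro h
      have := ih (by omega)
      have h2 := hE _ _ (G.down (l + 1 - (d + 1)) (by omega) (by omega))
      rw [show l + 1 - (d + 1) + 1 = l + 1 - d by omega] at h2
      omega
  rcases le_total i t with h | h
  · have h1 := a i t h le_rfl
    have h2 := a 0 i (by omega) h
    rw [G.hx] at h1
    exact ⟨by omega, by omega, by omega⟩
  · have h1 := b (i - t) (by omega)
    have h2 := c (l + 1 - i) (by omega)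
    rw [show t + (i - t) = i by omega] at h1
    rw [show l + 1 - (l + 1 - i) = i by omega, G.cl] at h2
    exact ⟨by omega, by omega, by omega⟩

end CyclePart

section Main

variable {n m : ℕ} {M : Fin n → Fin m → Bool}

lemma gall_cycle (N : PhyloNetwork M) {x : N.V} {g : ℕ → N.V} {t l : ℕ}
    (G : GallData N.edge x g t l) :
    ∃ p : N.underlying.Walk (g l) (g l), p.IsCycle ∧ ∀ v, v ∈ p.support ↔ ∃ i ≤ l, g i = v := by
  have ne : ∀ a b, N.edge a b → a ≠ b := by
    rintro a b h rfl; exact lt_irrefl _ (N.acyclic _ _ h)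
  refine cycle_of_fun _ g l G.hl ?_ G.cl G.inj
  intro i hi
  rw [PhyloNetwork.underlying, SimpleGraph.fromRel_adj]
  by_cases h : i < t
  · have := G.up i h
    exact ⟨ne _ _ this, Or.inl this⟩
  · have := G.down i (by omega) hi
    exact ⟨(ne _ _ this).symm, Or.inr this⟩

lemma gall_disjoint (N : PhyloNetwork M) (hN : N.IsGalled) {x y : N.V} {g g' : ℕ → N.V}
    {t l t' l' : ℕ} (G : GallData N.edge x g t l) (G' : GallData N.edge y g' t' l')
    {i j : ℕ} (hi : i ≤ l) (hj : j ≤ l') (h : g i = g' j) : x = y := by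
  obtain ⟨p, hp, sp⟩ := gall_cycle N G
  obtain ⟨q, hq, sq⟩ := gall_cycle N G'
  have key := hN _ _ p q hp hq ⟨g i, (sp _).2 ⟨i, hi, rfl⟩, (sq _).2 ⟨j, hj, h.symm⟩⟩
  obtain ⟨a, ha, ea⟩ := (sq x).1 ((key x).1 ((sp x).2 ⟨t, G.htl, G.hx⟩))
  obtain ⟨b, hb, eb⟩ := (sp y).1 ((key y).2 ((sq y).2 ⟨t', G'.htl, G'.hx⟩))
  obtain ⟨h1, h2, _⟩ := G'.rank_le N.acyclic a ha
  obtain ⟨h3, _, _⟩ := G.rank_le N.acyclic b hb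
  rw [ea] at h1 h2
  rw [eb] at h3
  have := h2 (by omega)
  rw [← ea, this, G'.hx]

/-- labels in a gall -/
lemma gall_changes (N : PhyloNetwork M) {x : N.V} {g : ℕ → N.V} {t l : ℕ}
    (G : GallData N.edge x g t l) (hx : {p | N.edge p x}.ncard = 2)
    (htree : ∀ i, 1 ≤ i → i ≤ l → i ≠ t → {p | N.edge p (g i)}.ncard = 1) (c : Fin m) :
    (∃ e₁ e₂, e₁ ≤ e₂ ∧ e₂ < l ∧
      ∀ i < l, N.label (g (i + 1)) c ≠ N.label (g i) c → i = e₁ ∨ i = e₂) ∧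
    ((∀ i, 1 ≤ i → i ≤ l → g i ≠ (N.charEdge c).2) →
      ∀ i < l, N.label (g (i + 1)) c = N.label (g i) c) := by
  have hl := G.hl
  have ht := G.ht
  have htl := G.htl
  have c1 : ∀ i, i + 1 < t → g (i + 1) ≠ (N.charEdge c).2 →
      N.label (g (i + 1)) c = N.label (g i) c := by
    intro i hi hne
    refine (N.tree_label _ _ (G.up i (by omega)) (htree _ (by omega) (by omega) (by omega)) c).2 ?_
    intro h; rw [h] at hne; exact hne rfl
  have c2 : ∀ i, t < i → i ≤ l → g i ≠ (N.charEdge c).2 →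
      N.label (g (i + 1)) c = N.label (g i) c := by
    intro i hi hil hne
    refine ((N.tree_label _ _ (G.down i (by omega) hil)
      (htree _ (by omega) (by omega) (by omega)) c).2 ?_).symm
    intro h; rw [h] at hne; exact hne rfl
  have cx : N.label x c = N.label (g (t - 1)) c ∨ N.label x c = N.label (g (t + 1)) c := by
    obtain ⟨p₁, p₂, hp, e1, e2, k, hk⟩ := N.recomb_label x hx
    have f1 : N.edge (g (t - 1)) x := by
      have := G.up (t - 1) (by omega)
      rwa [show t - 1 + 1 = t by omega, G.hx] at this
    have f2 : N.edge (g (t + 1)) x := by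
      have := G.down t le_rfl htl
      rwa [G.hx] at this
    have hne : g (t - 1) ≠ g (t + 1) := by
      intro h
      by_cases h' : t = l
      · rw [h', G.cl] at h
        have := G.inj _ (by omega) _ (by omega) h
        omega
      · have := G.inj _ (by omega) _ (by omega) h
        omega
    have hpar : ∀ p, N.edge p x → p = g (t - 1) ∨ p = g (t + 1) := by
      have := N.fin
      have hs : ({g (t - 1), g (t + 1)} : Set N.V) = {p | N.edge p x} := by
        apply Set.eq_of_subset_of_ncard_le
        · rintro p (rfl | rfl)
          · exact f1
          · exact f2
        · rw [hx, Set.ncard_pair hne]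
        · exact Set.toFinite _
      intro p hp
      have : p ∈ ({g (t - 1), g (t + 1)} : Set N.V) := by rw [hs]; exact hp
      simpa using this
    have : N.label x c = N.label p₁ c ∨ N.label x c = N.label p₂ c := by
      rcases lt_or_ge c.val k with h | h
      · exact Or.inl ((hk c).1 h)
      · exact Or.inr ((hk c).2 h)
    rcases this with h | h
    · rcases hpar _ e1 with e | e <;> rw [e] at h
      · exact Or.inl h
      · exact Or.inr h
    · rcases hpar _ e2 with e | e <;> rw [e] at h
      · exact Or.inl h
      · exact Or.inr h
  constructor
  · -- at most two changes
    have hA : ∃ e, ∀ i ≤ l, i + 1 ≠ t → i ≠ t → N.label (g (i + 1)) c ≠ N.label (g i) c → i = e := by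
      by_cases hv : ∃ s, 1 ≤ s ∧ s ≤ l ∧ g s = (N.charEdge c).2
      · obtain ⟨s, hs1, hsl, hs⟩ := hv
        refine ⟨if s < t then s - 1 else s, ?_⟩
        intro i hi h1 h2 hch
        rcases lt_or_gt_of_ne h2 with h | h
        · have : g (i + 1) = (N.charEdge c).2 := by
            by_contra hne; exact hch (c1 i (by omega) hne)
          have := G.inj _ (by omega) _ hsl (this.trans hs.symm)
          rw [if_pos (by omega)]; omega
        · have : g i = (N.charEdge c).2 := by
            by_contra hne; exact hch (c2 i h hi hne)
          have := G.inj _ (by omega) _ hsl (this.trans hs.symm)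
          rw [if_neg (by omega)]; omega
      · refine ⟨0, ?_⟩
        intro i hi h1 h2 hch
        exfalso
        rcases lt_or_gt_of_ne h2 with h | h
        · exact hch (c1 i (by omega) (fun e => hv ⟨i + 1, by omega, by omega, e⟩))
        · exact hch (c2 i h hi (fun e => hv ⟨i, by omega, by omega, e⟩))
    have hB : ∃ e, ∀ i, (i + 1 = t ∨ i = t) → N.label (g (i + 1)) c ≠ N.label (g i) c → i = e := by
      rcases cx with h | h
      · refine ⟨t, ?_⟩
        rintro i (rfl | rfl) hch
        · exfalso; apply hch
          rw [G.hx, h]; rfl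
        · rfl
      · refine ⟨t - 1, ?_⟩
        rintro i (rfl | rfl) hch
        · rfl
        · exfalso; apply hch
          rw [G.hx, h]
    obtain ⟨e, he⟩ := hA
    obtain ⟨e', he'⟩ := hB
    have hor : ∀ i < l, N.label (g (i + 1)) c ≠ N.label (g i) c → i = e ∨ i = e' := by
      intro i hi hch
      by_cases h : i + 1 = t ∨ i = t
      · exact Or.inr (he' i h hch)
      · push Not at h
        exact Or.inl (he i hi.le h.1 h.2 hch)
    refine ⟨min (min e (l - 1)) (min e' (l - 1)), max (min e (l - 1)) (min e' (l - 1)),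
      by omega, by omega, ?_⟩
    intro i hi hch
    rcases hor i hi hch with h | h <;> omega
  · intro hv
    have d1 : ∀ i, i < t → N.label (g i) c = N.label (g 0) c := by
      intro i
      induction i with
      | zero => intro _; rfl
      | succ i ih =>
        intro h
        rw [c1 i h (hv _ (by omega) (by omega)), ih (by omega)]
    have d2 : ∀ d, t + 1 + d ≤ l + 1 → N.label (g (t + 1 + d)) c = N.label (g (t + 1)) c := by
      intro d
      induction d with
      | zero => intro _; rfl
      | succ d ih =>
        intro h
        rw [← ih (by omega)]
        exact c2 (t + 1 + d) (by omega) (by omega) (hv _ (by omega) (by omega))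
    have d3 : N.label (g (t + 1)) c = N.label (g 0) c := by
      rw [← G.cl, ← d2 (l - t) (by omega)]
      congr 2; omega
    have d4 : N.label x c = N.label (g 0) c := by
      rcases cx with h | h
      · rw [h, d1 _ (by omega)]
      · rw [h, d3]
    have d5 : ∀ i ≤ l, N.label (g i) c = N.label (g 0) c := by
      intro i hi
      rcases lt_trichotomy i t with h | h | h
      · exact d1 i h
      · rw [h, G.hx, d4]
      · rw [← d3, ← d2 (i - t - 1) (by omega)]
        congr 2; omega
    intro i hi
    rw [d5 _ (by omega), d5 i (by omega)]

lemma galled_sets (N : PhyloNetwork M) (hN : N.IsGalled) :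
    ∃ f : N.V → N.V, ∀ c, ∃ A B : Set N.V, Lam f A ∧ Lam f B ∧ B ⊆ A ∧
      ∀ w, N.label w c = true ↔ (w ∈ A ∧ w ∉ B) := by
  classical
  have hex : ∀ x : N.V, ∃ (g : ℕ → N.V) (t l : ℕ), {p | N.edge p x}.ncard = 2 →
      GallData N.edge x g t l := by
    intro x
    by_cases hx : {p | N.edge p x}.ncard = 2
    · obtain ⟨p, q, hpq, hp, hq, _⟩ := N.recomb_label x hx
      obtain ⟨g, t, l, G⟩ := exists_gall N.acyclic N.reach hpq hp hq
      exact ⟨g, t, l, fun _ => G⟩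
    · exact ⟨fun _ => x, 0, 0, fun h => absurd h hx⟩
  choose g t l G using hex
  let Int : N.V → N.V → ℕ → Prop := fun w x i =>
    {p | N.edge p x}.ncard = 2 ∧ i < l x ∧ g x (i + 1) = w
  have Iuniq : ∀ w x i y j, Int w x i → Int w y j → x = y ∧ i = j := by
    rintro w x i y j ⟨hx, hi, e⟩ ⟨hy, hj, e'⟩
    have hxy : x = y := gall_disjoint N hN (G x hx) (G y hy) (i := i + 1) (j := j + 1)
      (by omega) (by omega) (e.trans e'.symm)
    subst hxy
    refine ⟨rfl, ?_⟩
    have := (G x hx).inj (i + 1) (by omega) (j + 1) (by omega) (e.trans e'.symm)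
    omega
  let f : N.V → N.V := fun w =>
    if h : ∃ y : N.V × ℕ, Int w y.1 y.2 then g h.choose.1 h.choose.2
    else if h2 : ∃ u, N.edge u w then h2.choose else w
  have f1 : ∀ w x i, Int w x i → f w = g x i := by
    intro w x i h
    have hh : ∃ y : N.V × ℕ, Int w y.1 y.2 := ⟨(x, i), h⟩
    have e := Iuniq _ _ _ _ _ hh.choose_spec h
    simp only [f, dif_pos hh]
    rw [e.1, e.2]
  have Ix : ∀ x, {p | N.edge p x}.ncard = 2 → Int x x (t x - 1) := by
    intro x hx
    have a := (G x hx).ht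
    have b := (G x hx).htl
    refine ⟨hx, by omega, ?_⟩
    rw [show t x - 1 + 1 = t x by omega, (G x hx).hx]
  have Iedge : ∀ w x i, Int w x i → ∃ u, N.edge u w := by
    rintro w x i ⟨hx, hi, rfl⟩
    by_cases h : i < t x
    · exact ⟨_, (G x hx).up i h⟩
    · exact ⟨_, (G x hx).down (i + 1) (by omega) (by omega)⟩
  have f2 : ∀ w, w ≠ N.root → (¬ ∃ y : N.V × ℕ, Int w y.1 y.2) →
      N.edge (f w) w ∧ {p | N.edge p w}.ncard = 1 := by
    intro w hw hI
    have h1 : {p | N.edge p w}.ncard = 1 := by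
      rcases N.indeg_nonroot w hw with h | h
      · exact h
      · exact absurd ⟨(w, t w - 1), Ix w h⟩ hI
    refine ⟨?_, h1⟩
    have h2 : ∃ u, N.edge u w := by
      obtain ⟨u, hu⟩ := Set.ncard_eq_one.1 h1
      refine ⟨u, ?_⟩
      have : u ∈ {p | N.edge p w} := by rw [hu]; rfl
      exact this
    simp only [f, dif_neg hI, dif_pos h2]
    exact h2.choose_spec
  have froot : f N.root = N.root := by
    have hI : ¬ ∃ y : N.V × ℕ, Int N.root y.1 y.2 := by
      rintro ⟨y, hy⟩
      obtain ⟨u, hu⟩ := Iedge _ _ _ hy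
      exact N.root_indeg u hu
    have h2 : ¬ ∃ u, N.edge u N.root := by
      rintro ⟨u, hu⟩; exact N.root_indeg u hu
    simp only [f, dif_neg hI, dif_neg h2]
  have fiter : ∀ x, {p | N.edge p x}.ncard = 2 → ∀ d i, i + d ≤ l x →
      f^[d] (g x (i + d)) = g x i := by
    intro x hx d
    induction d with
    | zero => intro i _; rfl
    | succ d ih =>
      intro i hi
      rw [Function.iterate_succ_apply, show i + (d + 1) = i + d + 1 by omega,
        f1 _ x (i + d) ⟨hx, by omega, rfl⟩]
      exact ih i (by omega)
  have freach : ∀ w, ∃ k, f^[k] w = N.root := by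
    have : ∀ r w, N.rank w = r → ∃ k, f^[k] w = N.root := by
      intro r
      induction r using Nat.strong_induction_on with
      | _ r ih =>
        intro w hr
        by_cases hw : w = N.root
        · exact ⟨0, hw⟩
        by_cases hI : ∃ y : N.V × ℕ, Int w y.1 y.2
        · obtain ⟨⟨x, i⟩, hx, hi, e⟩ := hI
          dsimp only at hx hi e
          have h1 := fiter x hx (i + 1) 0 (by omega)
          rw [zero_add, e] at h1
          have h2 := ((G x hx).rank_le N.acyclic (i + 1) (by omega)).2.2 (by omega)
          rw [e] at h2
          obtain ⟨k, hk⟩ := ih _ (hr ▸ h2) (g x 0) rfl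
          exact ⟨k + (i + 1), by rw [Function.iterate_add_apply, h1, hk]⟩
        · obtain ⟨he, _⟩ := f2 w hw hI
          obtain ⟨k, hk⟩ := ih _ (hr ▸ N.acyclic _ _ he) (f w) rfl
          exact ⟨k + 1, by rw [Function.iterate_succ_apply, hk]⟩
    exact fun w => this _ w rfl
  have htree : ∀ x, {p | N.edge p x}.ncard = 2 → ∀ i, 1 ≤ i → i ≤ l x → i ≠ t x →
      {p | N.edge p (g x i)}.ncard = 1 := by
    intro x hx i hi hil hit
    have hI : Int (g x i) x (i - 1) := ⟨hx, by omega, by rw [show i - 1 + 1 = i by omega]⟩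
    have hr : g x i ≠ N.root := by
      intro h
      obtain ⟨u, hu⟩ := Iedge _ _ _ hI
      rw [h] at hu; exact N.root_indeg u hu
    rcases N.indeg_nonroot _ hr with h | h
    · exact h
    · exfalso
      have e := Iuniq _ _ _ _ _ hI (Ix _ h)
      have := (G x hx).ht
      have e2 := e.2
      rw [← e.1] at e2
      omega
  refine ⟨f, fun c => ?_⟩
  obtain ⟨α, β, hαβ, hch⟩ : ∃ α β, Below f α β ∧
      ∀ w, w ≠ N.root → N.label w c ≠ N.label (f w) c → w = α ∨ w = β := by
    have nonint : ∀ w, w ≠ N.root → (¬ ∃ y : N.V × ℕ, Int w y.1 y.2) →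
        N.label w c ≠ N.label (f w) c → w = (N.charEdge c).2 := by
      intro w hw hI hne
      obtain ⟨he, h1⟩ := f2 w hw hI
      by_contra hc
      refine hne ((N.tree_label _ _ he h1 c).2 ?_)
      intro h; rw [h] at hc; exact hc rfl
    by_cases hv : ∃ y : N.V × ℕ, Int (N.charEdge c).2 y.1 y.2
    · obtain ⟨⟨x, s⟩, hs⟩ := hv
      dsimp only at hs
      have hx := hs.1
      obtain ⟨e₁, e₂, h12, h2l, hE⟩ := (gall_changes N (G x hx) hx (htree x hx) c).1
      refine ⟨g x (e₁ + 1), g x (e₂ + 1), ⟨e₂ - e₁, ?_⟩, ?_⟩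
      · have := fiter x hx (e₂ - e₁) (e₁ + 1) (by omega)
        rwa [show e₁ + 1 + (e₂ - e₁) = e₂ + 1 by omega] at this
      · intro w hw hne
        by_cases hI : ∃ y : N.V × ℕ, Int w y.1 y.2
        · obtain ⟨⟨y, i⟩, hy⟩ := hI
          dsimp only at hy
          rw [f1 _ _ _ hy] at hne
          obtain ⟨hy1, hy2, hy3⟩ := hy
          by_cases hxy : x = y
          · subst hxy
            rw [← hy3] at hne ⊢
            rcases hE i hy2 hne with h | h
            · left; rw [h]
            · right; rw [h]
          · exfalso
            rw [← hy3] at hne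
            refine hne ((gall_changes N (G y hy1) hy1 (htree y hy1) c).2 ?_ i hy2)
            intro j hj hjl e
            exact hxy (Iuniq _ _ _ _ _ hs
              (⟨hy1, by omega, by rw [show j - 1 + 1 = j by omega, e]⟩ : Int _ y (j - 1))).1
        · exact absurd ⟨(x, s), (nonint w hw hI hne) ▸ hs⟩ hI
    · refine ⟨(N.charEdge c).2, (N.charEdge c).2, Below.rfl' f _, ?_⟩
      intro w hw hne
      left
      by_cases hI : ∃ y : N.V × ℕ, Int w y.1 y.2
      · obtain ⟨⟨y, i⟩, hy⟩ := hI
        dsimp only at hy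
        exfalso
        rw [f1 _ _ _ hy] at hne
        obtain ⟨hy1, hy2, hy3⟩ := hy
        rw [← hy3] at hne
        refine hne ((gall_changes N (G y hy1) hy1 (htree y hy1) c).2 ?_ i hy2)
        intro j hj hjl e
        exact hv ⟨(y, j - 1), hy1, by dsimp only; omega,
          by dsimp only; rw [show j - 1 + 1 = j by omega, e]⟩
      · exact nonint w hw hI hne
  exact tree_part f N.root froot freach (fun w => N.label w c) (N.root_label c) α β hαβ hch

end Main

/-- If a binary matrix `M` can be represented by a galled tree, then there is a
completion `M'` of the extended matrix `M_e` of `M` such that no pair of columns of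
`M'` is conflicted. -/
theorem completion_no_conflicted_pair_of_galledTree
    (n m : ℕ) (M : Fin n → Fin m → Bool)
    (h : ∃ N : PhyloNetwork M, N.IsGalled) :
    ∃ M' : Fin n → Fin m × Bool → Bool,
      IsCompletion M M' ∧
        ∀ c d : Fin m × Bool, c ≠ d → ¬ Conflicted M' c d := by
  classical
  obtain ⟨N, hN⟩ := h
  obtain ⟨f, hf⟩ := galled_sets N hN
  choose A B hA hB hBA hAB using hf
  choose v hv using N.rows_appear
  let S : Fin m × Bool → Set N.V := fun c => if c.2 = true then B c.1 else A c.1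
  have hS : ∀ c, Lam f (S c) := by
    rintro ⟨c, b⟩
    cases b
    · exact hA c
    · exact hB c
  refine ⟨fun r c => decide (v r ∈ S c), ?_, ?_⟩
  · intro r j
    have h1 := hAB j (v r)
    rw [hv] at h1
    have h2 : v r ∈ B j → v r ∈ A j := fun h => hBA j h
    constructor
    · intro h
      simpa [S] using h1.1 h
    · intro h
      rw [h] at h1
      simp only [S]
      simp at h1 ⊢
      tauto
  · rintro c d _ ⟨⟨r1, a1, b1⟩, ⟨r2, a2, b2⟩, ⟨r3, a3, b3⟩⟩
    simp only [decide_eq_true_eq, decide_eq_false_iff_not] at a1 b1 a2 b2 a3 b3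
    rcases (hS c).laminar (hS d) a3 b3 with h | h
    · exact b2 (h a2)
    · exact a1 (h b1)
end
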